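/- Let H be a complex Hilbert space, V ⊆ B(H) a linear subspace with matrix norms ‖·‖_n inherited from B(H), and e ∈ V with ‖e‖ = 1. Let m be the trivial partial product (with domain (ℂe×V) ∪ (V×ℂe) and m(λe, x) = m(x, λe) = λx), and suppose the factorization seminorms ‖A‖_n^e := inf{ ‖X^{(1)}‖ ⋯ ‖X^{(N)}‖ : (X^{(1)}, …, X^{(N)}) permissible, A = X^{(1)} ⊙_m ⋯ ⊙_m X^{(N)} } are norms. Then: (a) there exist a Hilbert space K and a linear map π : V → B(K) with π(e) = I_K and ‖π^{(n)}(A)‖ = ‖A‖_n^e for all n and A ∈ M_n(V); and (b) if {‖·‖_n^*} is any family of norms on the spaces M_n(V) such that ‖x‖_n^* ≤ ‖x‖_n for all x ∈ M_n(V) and such that there exist a Hilbert space L and a linear map ρ : V → B(L) with ρ(e) = I_L and ‖ρ^{(n)}(x)‖ = ‖x‖_n^* for all n and x ∈ M_n(V), then ‖x‖_n^* ≤ ‖x‖_n^e for all n and x ∈ M_n(V). -/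

import Mathlib

noncomputable section

open scoped BigOperators

/-- A partial product on a complex vector space `V` with distinguished element `e`:
a domain `D ⊆ V × V` together with subspaces `R x` and `L x` (each containing `e`) witnessing
the domain conditions, and a (partially meaningful) product `m` which is unital and bilinear
where defined. -/
structure PartialProduct (V : Type*) [AddCommGroup V] [Module ℂ V] (e : V) where
  /-- The domain of the partial product. -/
  D : Set (V × V)
  /-- The partial product (as a total function; only its values on `D` are meaningful). -/
  m : V → V → V
  /-- For each `x`, a unital subspace `R x` with `ℂx × R x ⊆ D`. -/
  R : V → Submodule ℂ V
  /-- For each `y`, a unital subspace `L y` with `L y × ℂy ⊆ D`. -/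
  L : V → Submodule ℂ V
  unit_left : ∀ (c : ℂ) (x : V), (c • e, x) ∈ D
  unit_right : ∀ (c : ℂ) (x : V), (x, c • e) ∈ D
  e_mem_R : ∀ x : V, e ∈ R x
  e_mem_L : ∀ y : V, e ∈ L y
  mem_right : ∀ (x : V) (c : ℂ) (r : V), r ∈ R x → (c • x, r) ∈ D
  mem_left : ∀ (y : V) (c : ℂ) (l : V), l ∈ L y → (l, c • y) ∈ D
  m_unital_left : ∀ x : V, m e x = x
  m_unital_right : ∀ x : V, m x e = x
  m_add_left : ∀ (x y z : V) (c : ℂ), y ∈ L x → z ∈ L x →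
    m (y + c • z) x = m y x + c • m z x
  m_add_right : ∀ (x y z : V) (c : ℂ), y ∈ R x → z ∈ R x →
    m x (y + c • z) = m x y + c • m x z

/-- A pair of matrices over `V` is a valid pair for a partial product when all the relevant
entry pairs lie in the domain. -/
def PartialProduct.ValidPair {V : Type*} [AddCommGroup V] [Module ℂ V] {e : V}
    (P : PartialProduct V e) {n k l : ℕ}
    (A : Matrix (Fin n) (Fin k) V) (B : Matrix (Fin k) (Fin l) V) : Prop :=
  ∀ (i : Fin n) (r : Fin k) (j : Fin l), (A i r, B r j) ∈ P.D

/-- The matrix product `A ⊙_m B` of a valid pair. -/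
def PartialProduct.odot {V : Type*} [AddCommGroup V] [Module ℂ V] {e : V}
    (P : PartialProduct V e) {n k l : ℕ}
    (A : Matrix (Fin n) (Fin k) V) (B : Matrix (Fin k) (Fin l) V) :
    Matrix (Fin n) (Fin l) V :=
  Matrix.of fun i j => ∑ r, P.m (A i r) (B r j)

/-- The relation on the free (tensor) algebra `F(V)` identifying `a · b` with `m(a, b)` for
`(a, b) ∈ D`. -/
def PartialProduct.rel {V : Type*} [AddCommGroup V] [Module ℂ V] {e : V}
    (P : PartialProduct V e) :
    TensorAlgebra ℂ V → TensorAlgebra ℂ V → Prop := fun p q =>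
  ∃ a b : V, (a, b) ∈ P.D ∧
    p = TensorAlgebra.ι ℂ a * TensorAlgebra.ι ℂ b ∧ q = TensorAlgebra.ι ℂ (P.m a b)

/-- The algebra `F_m(V) = F(V)/J_m`. -/
abbrev PartialProduct.FreeAlg {V : Type*} [AddCommGroup V] [Module ℂ V] {e : V}
    (P : PartialProduct V e) : Type _ := RingQuot P.rel

/-- The canonical map `V → F_m(V)`, `v ↦ v + J_m`. -/
noncomputable def PartialProduct.emb {V : Type*} [AddCommGroup V] [Module ℂ V] {e : V}
    (P : PartialProduct V e) : V → P.FreeAlg :=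
  fun v => RingQuot.mkAlgHom ℂ P.rel (TensorAlgebra.ι ℂ v)

/-- A chain (tuple) of matrices over `V` with compatible dimensions, starting with `n` rows
and ending with `k` columns. -/
structure MatChain (V : Type*) (n k : ℕ) where
  /-- the number of matrices in the chain -/
  len : ℕ
  /-- the sequence of dimensions -/
  dims : Fin (len + 1) → ℕ
  dim_first : dims 0 = n
  dim_last : dims (Fin.last len) = k
  /-- the matrices: the `i`-th matrix has size `dims i × dims (i+1)` -/
  mats : ∀ i : Fin len, Matrix (Fin (dims i.castSucc)) (Fin (dims i.succ)) V

/-- The product of a chain of matrices over `V`, computed in a semiring `R` via a map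
`f : V → R`: the usual iterated matrix product `f(X⁽¹⁾) f(X⁽²⁾) ⋯ f(X⁽ᴺ⁾)`. -/
noncomputable def MatChain.prodIn {V : Type*} {n k : ℕ} (C : MatChain V n k)
    {R : Type*} [Semiring R] (f : V → R) : Matrix (Fin n) (Fin k) R :=
  Matrix.of fun i j =>
    ∑ p ∈ Finset.univ.filter
        (fun p : (∀ t : Fin (C.len + 1), Fin (C.dims t)) =>
          p 0 = Fin.cast C.dim_first.symm i ∧ p (Fin.last C.len) = Fin.cast C.dim_last.symm j),
      (List.ofFn fun t : Fin C.len => f (C.mats t (p t.castSucc) (p t.succ))).prod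

variable {H : Type} [NormedAddCommGroup H] [InnerProductSpace ℂ H] [CompleteSpace H]

/-- A matrix over `B(H)` viewed as a bounded operator between the `ℓ²`-direct sums `H^κ → H^ι`. -/
noncomputable def opMatCLM {ι κ : Type} [Fintype ι] [Fintype κ]
    (A : Matrix ι κ (H →L[ℂ] H)) :
    PiLp 2 (fun _ : κ => H) →L[ℂ] PiLp 2 (fun _ : ι => H) :=
  ((PiLp.continuousLinearEquiv 2 ℂ (fun _ : ι => H)).symm.toContinuousLinearMap) ∘L
    (ContinuousLinearMap.pi fun i => ∑ j, (A i j).comp (ContinuousLinearMap.proj j)) ∘L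
    ((PiLp.continuousLinearEquiv 2 ℂ (fun _ : κ => H)).toContinuousLinearMap)

/-- The operator norm of a matrix over `B(H)`, viewed as an operator `H^κ → H^ι`. -/
noncomputable def opMatNorm {ι κ : Type} [Fintype ι] [Fintype κ]
    (A : Matrix ι κ (H →L[ℂ] H)) : ℝ := ‖opMatCLM A‖

/-- The norm of a matrix over a subspace `X ⊆ B(H)`, computed in `B(H)`. -/
noncomputable def subMatNorm {X : Submodule ℂ (H →L[ℂ] H)} {ι κ : Type} [Fintype ι] [Fintype κ]
    (A : Matrix ι κ ↥X) : ℝ := opMatNorm (A.map (fun v => (v : H →L[ℂ] H)))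

/-- The cost of a chain of matrices over `X ⊆ B(H)`: the product of the norms of its
matrices. -/
noncomputable def chainCost {X : Submodule ℂ (H →L[ℂ] H)} {n k : ℕ}
    (C : MatChain ↥X n k) : ℝ :=
  ∏ t : Fin C.len, subMatNorm (C.mats t)

/-- The factorization seminorm `‖A‖^m`: the infimum of `‖X⁽¹⁾‖ ⋯ ‖X⁽ᴺ⁾‖` over all permissible
factorizations `A = X⁽¹⁾ ⊙_m ⋯ ⊙_m X⁽ᴺ⁾` (chains of matrices over `X` whose iterated product,
computed in `F_m(X)`, equals the image of `A`). -/
noncomputable def factNorm {X : Submodule ℂ (H →L[ℂ] H)} {e : ↥X}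
    (P : PartialProduct ↥X e) {n k : ℕ} (A : Matrix (Fin n) (Fin k) ↥X) : ℝ :=
  sInf { r : ℝ | ∃ C : MatChain ↥X n k, 1 ≤ C.len ∧
    C.prodIn P.emb = A.map P.emb ∧ r = chainCost C }

section TrivialProduct

open Classical

variable {W : Type*} [AddCommGroup W] [Module ℂ W]

/-- The trivial partial product with unit `e` on a complex vector space:
`m(λ e, x) = m(x, λ e) = λ x` (as a total function, defined by these formulas on the domain
`(ℂe × W) ∪ (W × ℂe)` and by `0` elsewhere). -/
noncomputable def trivMul (e : W) : W → W → W := fun a b =>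
  if h : ∃ c : ℂ, a = c • e then h.choose • b
  else if h' : ∃ c : ℂ, b = c • e then h'.choose • a
  else 0

lemma smul_unit_cancel {e : W} (he : e ≠ 0) (c d : ℂ) (h : c • e = d • e) : c = d := by
  by_contra hcd
  have h1 : (c - d) • e = 0 := by rw [sub_smul, h, sub_self]
  have h2 : (c - d) ≠ 0 := sub_ne_zero.mpr hcd
  apply he
  calc e = (c - d)⁻¹ • ((c - d) • e) := by
            rw [smul_smul, inv_mul_cancel₀ h2, one_smul]
    _ = 0 := by rw [h1, smul_zero]

lemma trivMul_smul_left {e : W} (he : e ≠ 0) (c : ℂ) (x : W) :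
    trivMul e (c • e) x = c • x := by
  have h : ∃ d : ℂ, c • e = d • e := ⟨c, rfl⟩
  have hc : h.choose = c := (smul_unit_cancel he _ _ h.choose_spec).symm
  simp only [trivMul, dif_pos h, hc]

lemma trivMul_smul_right {e : W} (he : e ≠ 0) (c : ℂ) (x : W) :
    trivMul e x (c • e) = c • x := by
  by_cases h : ∃ d : ℂ, x = d • e
  · obtain ⟨d, rfl⟩ := h
    rw [trivMul_smul_left he d (c • e)]
    exact smul_comm d c e
  · have h' : ∃ d : ℂ, c • e = d • e := ⟨c, rfl⟩
    have hc : h'.choose = c := (smul_unit_cancel he _ _ h'.choose_spec).symm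
    simp only [trivMul, dif_neg h, dif_pos h', hc]

/-- The trivial partial product on a complex vector space `W` with unit `e ≠ 0`, with domain
`(ℂe × W) ∪ (W × ℂe)`. -/
noncomputable def trivPP {e : W} (hne : e ≠ 0) : PartialProduct W e where
  D := {p | ∃ c : ℂ, p.1 = c • e} ∪ {p | ∃ c : ℂ, p.2 = c • e}
  m := trivMul e
  R := fun _ => Submodule.span ℂ {e}
  L := fun _ => Submodule.span ℂ {e}
  unit_left := fun c x => Or.inl ⟨c, rfl⟩
  unit_right := fun c x => Or.inr ⟨c, rfl⟩
  e_mem_R := fun _ => Submodule.mem_span_singleton_self e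
  e_mem_L := fun _ => Submodule.mem_span_singleton_self e
  mem_right := by
    intro x c r hr
    obtain ⟨a, rfl⟩ := Submodule.mem_span_singleton.mp hr
    exact Or.inr ⟨a, rfl⟩
  mem_left := by
    intro y c l hl
    obtain ⟨a, rfl⟩ := Submodule.mem_span_singleton.mp hl
    exact Or.inl ⟨a, rfl⟩
  m_unital_left := by
    intro x
    have := trivMul_smul_left hne 1 x
    simpa using this
  m_unital_right := by
    intro x
    have := trivMul_smul_right hne 1 x
    simpa using this
  m_add_left := by
    intro x y z c hy hz
    obtain ⟨a, rfl⟩ := Submodule.mem_span_singleton.mp hy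
    obtain ⟨b, rfl⟩ := Submodule.mem_span_singleton.mp hz
    rw [smul_smul, ← add_smul, trivMul_smul_left hne, trivMul_smul_left hne,
      trivMul_smul_left hne, smul_smul, ← add_smul]
  m_add_right := by
    intro x y z c hy hz
    obtain ⟨a, rfl⟩ := Submodule.mem_span_singleton.mp hy
    obtain ⟨b, rfl⟩ := Submodule.mem_span_singleton.mp hz
    rw [smul_smul, ← add_smul, trivMul_smul_right hne, trivMul_smul_right hne,
      trivMul_smul_right hne, smul_smul, ← add_smul]

end TrivialProduct

/-! ### Operator norms of matrices over `B(H)` -/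

set_option linter.unusedSectionVars false

section OpMatNorm

variable {ι κ μ ι' κ' : Type} [Fintype ι] [Fintype κ] [Fintype μ] [Fintype ι'] [Fintype κ']

lemma opMatCLM_apply (A : Matrix ι κ (H →L[ℂ] H)) (x : PiLp 2 (fun _ : κ => H)) (i : ι) :
    opMatCLM A x i = ∑ j, A i j (x j) := by
  simp [opMatCLM]

lemma opMatNorm_nonneg (A : Matrix ι κ (H →L[ℂ] H)) : 0 ≤ opMatNorm A := norm_nonneg (opMatCLM A)

lemma sum_norm_sq_le_opMatNorm (A : Matrix ι κ (H →L[ℂ] H)) (x : κ → H) :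
    ∑ i, ‖∑ j, A i j (x j)‖ ^ 2 ≤ opMatNorm A ^ 2 * ∑ j, ‖x j‖ ^ 2 := by
  have h := (opMatCLM A).le_opNorm (WithLp.toLp 2 x)
  have h2 := pow_le_pow_left₀ (norm_nonneg _) h 2
  rw [mul_pow, PiLp.norm_sq_eq_of_L2, PiLp.norm_sq_eq_of_L2] at h2
  simpa only [opMatCLM_apply, opMatNorm] using h2

lemma opMatNorm_le {A : Matrix ι κ (H →L[ℂ] H)} {c : ℝ} (hc : 0 ≤ c)
    (h : ∀ x : κ → H, ∑ i, ‖∑ j, A i j (x j)‖ ^ 2 ≤ c ^ 2 * ∑ j, ‖x j‖ ^ 2) :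
    opMatNorm A ≤ c := by
  refine (opMatCLM A).opNorm_le_bound hc fun x => ?_
  refine le_of_sq_le_sq ?_ (mul_nonneg hc (norm_nonneg x))
  rw [mul_pow, PiLp.norm_sq_eq_of_L2, PiLp.norm_sq_eq_of_L2]
  simpa only [opMatCLM_apply] using h x

lemma opMatNorm_le_one_iff {A : Matrix ι κ (H →L[ℂ] H)} :
    opMatNorm A ≤ 1 ↔ ∀ x : κ → H, ∑ i, ‖∑ j, A i j (x j)‖ ^ 2 ≤ ∑ j, ‖x j‖ ^ 2 := by
  refine ⟨fun h x => (sum_norm_sq_le_opMatNorm A x).trans ?_,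
    fun h => opMatNorm_le zero_le_one (by simpa using h)⟩
  exact mul_le_of_le_one_left (by positivity) (pow_le_one₀ (opMatNorm_nonneg A) h)

lemma opMatNorm_submatrix_le (A : Matrix ι κ (H →L[ℂ] H)) (e₁ : ι' ≃ ι) (e₂ : κ' ≃ κ) :
    opMatNorm (A.submatrix e₁ e₂) ≤ opMatNorm A := by
  refine opMatNorm_le (opMatNorm_nonneg A) fun x => ?_
  have h := sum_norm_sq_le_opMatNorm A (x ∘ e₂.symm)
  rw [← e₁.sum_comp, ← e₂.sum_comp (fun j => ‖(x ∘ e₂.symm) j‖ ^ 2)] at h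
  simp_rw [← e₂.sum_comp (fun j => A _ j ((x ∘ e₂.symm) j))] at h
  simpa using h

lemma opMatNorm_submatrix (A : Matrix ι κ (H →L[ℂ] H)) (e₁ : ι' ≃ ι) (e₂ : κ' ≃ κ) :
    opMatNorm (A.submatrix e₁ e₂) = opMatNorm A := by
  refine le_antisymm (opMatNorm_submatrix_le A e₁ e₂) ?_
  simpa using opMatNorm_submatrix_le (A.submatrix e₁ e₂) e₁.symm e₂.symm

lemma opMatNorm_fromBlocks_le_one {A : Matrix ι κ (H →L[ℂ] H)} {B : Matrix ι' κ' (H →L[ℂ] H)}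
    (hA : opMatNorm A ≤ 1) (hB : opMatNorm B ≤ 1) :
    opMatNorm (Matrix.fromBlocks A 0 0 B) ≤ 1 := by
  rw [opMatNorm_le_one_iff] at *
  intro x
  simpa [Fintype.sum_sum_type] using add_le_add (hA (x ∘ Sum.inl)) (hB (x ∘ Sum.inr))

lemma opMatNorm_fromBlocks_zero (A : Matrix ι κ (H →L[ℂ] H)) :
    opMatNorm (Matrix.fromBlocks 0 A 0 0 : Matrix (ι ⊕ κ) (ι ⊕ κ) _) = opMatNorm A := by
  refine le_antisymm (opMatNorm_le (opMatNorm_nonneg A) fun x => ?_)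
    (opMatNorm_le (opMatNorm_nonneg _) fun x => ?_)
  · have h := sum_norm_sq_le_opMatNorm A (x ∘ Sum.inr)
    simp only [Fintype.sum_sum_type, Matrix.fromBlocks_apply₁₁, Matrix.fromBlocks_apply₁₂,
      Matrix.fromBlocks_apply₂₁, Matrix.fromBlocks_apply₂₂, Matrix.zero_apply,
      zero_apply, Finset.sum_const_zero, zero_add, norm_zero,
      ne_eq, OfNat.ofNat_ne_zero, not_false_eq_true, zero_pow, add_zero]
    refine h.trans (mul_le_mul_of_nonneg_left ?_ (by positivity))
    simpa using Finset.sum_nonneg fun i _ => by positivity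
  · simpa [Fintype.sum_sum_type] using sum_norm_sq_le_opMatNorm
      (Matrix.fromBlocks 0 A 0 0 : Matrix (ι ⊕ κ) (ι ⊕ κ) _) (Sum.elim 0 x)

lemma opMatNorm_mul_le (A : Matrix ι κ (H →L[ℂ] H)) (B : Matrix κ μ (H →L[ℂ] H)) :
    opMatNorm (A * B) ≤ opMatNorm A * opMatNorm B := by
  refine opMatNorm_le (mul_nonneg (opMatNorm_nonneg A) (opMatNorm_nonneg B)) fun x => ?_
  have hx : ∀ i, ∑ j, (A * B) i j (x j) = ∑ k, A i k (∑ j, B k j (x j)) := fun i => by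
    simp only [Matrix.mul_apply, sum_apply, map_sum,
      mul_apply_eq_comp]
    exact Finset.sum_comm
  simp_rw [hx]
  refine (sum_norm_sq_le_opMatNorm A _).trans ?_
  rw [mul_pow, mul_assoc]
  exact mul_le_mul_of_nonneg_left (sum_norm_sq_le_opMatNorm B x) (by positivity)

lemma opMatNorm_smul_le (c : ℂ) (A : Matrix ι κ (H →L[ℂ] H)) :
    opMatNorm (c • A) ≤ ‖c‖ * opMatNorm A := by
  refine opMatNorm_le (mul_nonneg (norm_nonneg c) (opMatNorm_nonneg A)) fun x => ?_
  simp only [Matrix.smul_apply, smul_apply, ← Finset.smul_sum, norm_smul,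
    mul_pow, ← Finset.mul_sum, mul_assoc]
  exact mul_le_mul_of_nonneg_left (sum_norm_sq_le_opMatNorm A x) (by positivity)

/-- A scalar matrix which is a contraction between finite-dimensional Hilbert spaces. -/
def IsScalarContraction (α : Matrix ι κ ℂ) : Prop :=
  ∀ x : κ → ℂ, ∑ i, ‖∑ j, α i j * x j‖ ^ 2 ≤ ∑ j, ‖x j‖ ^ 2

/-- A scalar contraction acts contractively on tuples of vectors of any Hilbert space. -/
lemma IsScalarContraction.sum_norm_sq_le {G : Type*} [NormedAddCommGroup G]
    [InnerProductSpace ℂ G] {α : Matrix ι κ ℂ} (hα : IsScalarContraction α) (x : κ → G) :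
    ∑ i, ‖∑ j, α i j • x j‖ ^ 2 ≤ ∑ j, ‖x j‖ ^ 2 := by
  let S := Submodule.span ℂ (Set.range x)
  have : FiniteDimensional ℂ S := FiniteDimensional.span_of_finite ℂ (Set.finite_range x)
  let b := stdOrthonormalBasis ℂ S
  let y : κ → S := fun j => ⟨x j, Submodule.subset_span ⟨j, rfl⟩⟩
  suffices h : ∑ i, ‖∑ j, α i j • y j‖ ^ 2 ≤ ∑ j, ‖y j‖ ^ 2 by
    simpa only [Submodule.coe_norm, Submodule.coe_sum, Submodule.coe_smul, y] using h
  simp_rw [← b.sum_sq_norm_inner_right]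
  rw [Finset.sum_comm, Finset.sum_comm (s := (Finset.univ : Finset κ))]
  refine Finset.sum_le_sum fun k _ => ?_
  simpa [inner_sum, inner_smul_right] using hα fun j => inner ℂ (b k) (y j)

lemma IsScalarContraction.opMatNorm_le_one {α : Matrix ι κ ℂ} (hα : IsScalarContraction α)
    {T : H →L[ℂ] H} (hT : ‖T‖ ≤ 1) : opMatNorm (α.map fun c => c • T) ≤ 1 := by
  rw [opMatNorm_le_one_iff]
  intro x
  refine le_trans (Finset.sum_le_sum fun i _ => ?_) (hα.sum_norm_sq_le x)
  have h : ∑ j, (α.map fun c => c • T) i j (x j) = T (∑ j, α i j • x j) := by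
    simp
  rw [h]
  exact pow_le_pow_left₀ (norm_nonneg _) (T.le_of_opNorm_le hT _ |>.trans (by simp)) 2

end OpMatNorm

/-! ### Chains of matrices -/

namespace MatChain

variable {W : Type*} {R S : Type*} [Semiring R] [Semiring S]

lemma prodIn_zero (n : ℕ)
    (mats : ∀ _ : Fin 0, Matrix (Fin n) (Fin n) W) (f : W → R) :
    (⟨0, fun _ => n, rfl, rfl, mats⟩ : MatChain W n n).prodIn f = 1 := by
  ext i j
  have h : (Finset.univ.filter fun p : (∀ _ : Fin 1, Fin n) =>
      p 0 = i ∧ p (Fin.last 0) = j) = if i = j then {fun _ => i} else ∅ := by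
    ext p
    have hp : p = (fun _ => i) ↔ p 0 = i := by
      refine ⟨fun h => by rw [h], fun h => funext fun t => ?_⟩
      obtain rfl : t = 0 := Subsingleton.elim _ _
      exact h
    split_ifs with hij
    · subst hij
      rw [Finset.mem_singleton, hp]
      simp
    · simp only [Finset.mem_filter, Finset.mem_univ, true_and, Finset.notMem_empty, iff_false]
      rintro ⟨rfl, h⟩
      exact hij h
  change ∑ p ∈ Finset.univ.filter fun p : (∀ _ : Fin 1, Fin n) =>
      p 0 = i ∧ p (Fin.last 0) = j, _ = _
  rw [h]
  by_cases hij : i = j <;> simp [hij, Matrix.one_apply]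

lemma prodIn_succ {N : ℕ} (dims : Fin (N + 2) → ℕ)
    (mats : ∀ i : Fin (N + 1), Matrix (Fin (dims i.castSucc)) (Fin (dims i.succ)) W) (f : W → R) :
    (⟨N + 1, dims, rfl, rfl, mats⟩ : MatChain W (dims 0) (dims (Fin.last (N + 1)))).prodIn f =
      (mats 0).map f * (⟨N, fun t => dims t.succ, rfl, rfl, fun t => mats t.succ⟩ :
        MatChain W (dims (Fin.succ 0)) (dims (Fin.last (N + 1)))).prodIn f := by
  ext i j
  change ∑ p ∈ Finset.univ.filter fun p : (∀ t : Fin (N + 2), Fin (dims t)) =>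
      p 0 = i ∧ p (Fin.last (N + 1)) = j,
      (List.ofFn fun t : Fin (N + 1) => f (mats t (p t.castSucc) (p t.succ))).prod =
    ∑ r, f (mats 0 i r) * ∑ q ∈ Finset.univ.filter
      fun q : (∀ t : Fin (N + 1), Fin (dims t.succ)) => q 0 = r ∧ q (Fin.last N) = j,
      (List.ofFn fun t : Fin N => f (mats t.succ (q t.castSucc) (q t.succ))).prod
  simp only [Finset.sum_filter, Finset.mul_sum]
  rw [← (Fin.consEquiv fun t => Fin (dims t)).sum_comp, Fintype.sum_prod_type,
    Finset.sum_eq_single i, Finset.sum_comm]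
  · refine Finset.sum_congr rfl fun q _ => ?_
    rw [Finset.sum_eq_single (q 0)]
    · simp only [Fin.consEquiv, Equiv.coe_fn_mk, Fin.cons_zero, true_and, List.ofFn_succ,
        List.prod_cons, mul_ite, mul_zero]
      rfl
    · intro r _ hr
      rw [if_neg fun h => hr h.1.symm, mul_zero]
    · exact fun h => absurd (Finset.mem_univ _) h
  · intro a _ ha
    refine Finset.sum_eq_zero fun q _ => if_neg ?_
    simp [Fin.consEquiv, ha]
  · simp

/-- The chain with one more matrix in front. -/
def cons {n d k : ℕ} (X : Matrix (Fin n) (Fin d) W) (C : MatChain W d k) : MatChain W n k :=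
  match d, k, C, X with
  | _, _, ⟨N, dims, rfl, rfl, mats⟩, X =>
    ⟨N + 1, Fin.cons n dims, rfl, rfl,
      Fin.cases (motive := fun i => Matrix (Fin ((Fin.cons n dims : Fin (N + 2) → ℕ) i.castSucc))
        (Fin ((Fin.cons n dims : Fin (N + 2) → ℕ) i.succ)) W) X mats⟩

lemma prodIn_cons {n d k : ℕ} (X : Matrix (Fin n) (Fin d) W) (C : MatChain W d k) (f : W → R) :
    (cons X C).prodIn f = X.map f * C.prodIn f := by
  obtain ⟨N, dims, rfl, rfl, mats⟩ := C
  exact prodIn_succ (Fin.cons n dims) _ f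

lemma one_le_len_cons {n d k : ℕ} (X : Matrix (Fin n) (Fin d) W) (C : MatChain W d k) :
    1 ≤ (cons X C).len := by
  obtain ⟨N, dims, rfl, rfl, mats⟩ := C
  exact Nat.succ_le_succ (Nat.zero_le N)

/-- The empty chain. -/
def nil (n : ℕ) : MatChain W n n := ⟨0, fun _ => n, rfl, rfl, fun i => i.elim0⟩

lemma prodIn_nil (n : ℕ) (f : W → R) : (nil n : MatChain W n n).prodIn f = 1 :=
  prodIn_zero n _ f

lemma chainCost_nil {V : Submodule ℂ (H →L[ℂ] H)} (n : ℕ) :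
    chainCost (nil n : MatChain ↥V n n) = 1 :=
  Finset.prod_empty

lemma chainCost_cons {V : Submodule ℂ (H →L[ℂ] H)} {n d k : ℕ} (X : Matrix (Fin n) (Fin d) ↥V)
    (C : MatChain ↥V d k) : chainCost (cons X C) = subMatNorm X * chainCost C := by
  obtain ⟨N, dims, rfl, rfl, mats⟩ := C
  exact Fin.prod_univ_succ _

lemma prodIn_comp {n k : ℕ} (C : MatChain W n k) (f : W → R) (g : R →+* S) :
    C.prodIn (fun v => g (f v)) = (C.prodIn f).map g := by
  ext i j
  simp [prodIn, map_list_prod, List.map_ofFn, Function.comp_def]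

lemma opMatNorm_prodIn_le {V : Submodule ℂ (H →L[ℂ] H)} {L : Type} [NormedAddCommGroup L]
    [InnerProductSpace ℂ L] [CompleteSpace L] (ρ : ↥V → (L →L[ℂ] L))
    (hρ : ∀ (a b : ℕ) (X : Matrix (Fin a) (Fin b) ↥V), opMatNorm (X.map ρ) ≤ subMatNorm X)
    {n k : ℕ} (C : MatChain ↥V n k) : opMatNorm (C.prodIn ρ) ≤ chainCost C := by
  obtain ⟨N, dims, rfl, rfl, mats⟩ := C
  induction N with
  | zero =>
    obtain ⟨n, rfl⟩ : ∃ n, dims = fun _ => n :=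
      ⟨dims 0, funext fun t => congrArg dims (Fin.fin_one_eq_zero t)⟩
    refine le_trans (b := 1) ?_ (Finset.prod_empty (M := ℝ)).ge
    have h1 : MatChain.prodIn (⟨0, fun _ => n, rfl, rfl, mats⟩ : MatChain ↥V n n) ρ = 1 :=
      prodIn_zero n mats ρ
    refine (congrArg opMatNorm h1).trans_le (opMatNorm_le_one_iff.2 fun x => ?_)
    refine Finset.sum_le_sum fun i _ => ?_
    rw [Finset.sum_eq_single i (fun j _ hj => by simp [Matrix.one_apply_ne hj.symm]) (by simp)]
    simp
  | succ N ih =>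
    rw [prodIn_succ]
    refine (opMatNorm_mul_le _ _).trans ?_
    refine (mul_le_mul (hρ _ _ _) (ih (fun t => dims t.succ) fun t => mats t.succ)
      (opMatNorm_nonneg _) (opMatNorm_nonneg _)).trans ?_
    exact (Fin.prod_univ_succ fun t : Fin (N + 1) => subMatNorm (mats t)).ge

end MatChain

/-! ### Scalar contractions -/

section ScalarContraction

variable {ι κ : Type} [Fintype ι] [Fintype κ]

/-- A finite-dimensional, purely algebraic form of Douglas' factorization lemma. -/
lemma exists_isScalarContraction_of_dual_le {E : Type*} [AddCommGroup E] [Module ℂ E]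
    (a : ι → E) (b : κ → E)
    (h : ∀ φ : Module.Dual ℂ E, ∑ i, ‖φ (a i)‖ ^ 2 ≤ ∑ j, ‖φ (b j)‖ ^ 2) :
    ∃ U : Matrix ι κ ℂ, IsScalarContraction U ∧ ∀ i, a i = ∑ j, U i j • b j := by
  classical
  let α : Module.Dual ℂ E →ₗ[ℂ] EuclideanSpace ℂ ι :=
    (WithLp.linearEquiv 2 ℂ (ι → ℂ)).symm.toLinearMap ∘ₗ LinearMap.pi fun i => Module.Dual.eval ℂ E (a i)
  let β : Module.Dual ℂ E →ₗ[ℂ] EuclideanSpace ℂ κ :=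
    (WithLp.linearEquiv 2 ℂ (κ → ℂ)).symm.toLinearMap ∘ₗ LinearMap.pi fun j => Module.Dual.eval ℂ E (b j)
  have hα : ∀ φ i, α φ i = φ (a i) := fun _ _ => rfl
  have hβ : ∀ φ j, β φ j = φ (b j) := fun _ _ => rfl
  have hle : ∀ φ, ‖α φ‖ ≤ ‖β φ‖ := fun φ => by
    refine le_of_sq_le_sq ?_ (norm_nonneg _)
    simpa only [EuclideanSpace.norm_sq_eq, hα, hβ] using h φ
  obtain ⟨g, hg⟩ := β.rangeRestrict.exists_rightInverse_of_surjective β.range_rangeRestrict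
  have hg' : ∀ y : LinearMap.range β, β (g y) = y := fun y => congrArg Subtype.val
    (LinearMap.congr_fun hg y)
  let P := (LinearMap.range β).orthogonalProjectionOnto
  let T : EuclideanSpace ℂ κ →ₗ[ℂ] EuclideanSpace ℂ ι := α ∘ₗ g ∘ₗ P.toLinearMap
  have hT : ∀ x, ‖T x‖ ≤ ‖x‖ := fun x =>
    calc ‖T x‖ ≤ ‖β (g (P x))‖ := hle _
      _ = ‖P x‖ := by rw [hg']; rfl
      _ ≤ ‖x‖ := (LinearMap.range β).norm_orthogonalProjectionOnto_apply_le x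
  have hTβ : ∀ φ, T (β φ) = α φ := fun φ => by
    have h1 : P (β φ) = ⟨β φ, φ, rfl⟩ :=
      Submodule.orthogonalProjectionOnto_mem_subspace_eq_self (⟨β φ, φ, rfl⟩ : LinearMap.range β)
    have h2 : ‖α (g (P (β φ)) - φ)‖ ≤ 0 := (hle _).trans (by rw [map_sub, hg', h1]; simp)
    rw [map_sub] at h2
    exact sub_eq_zero.1 (norm_le_zero_iff.1 h2)
  have hU : ∀ x i, T x i = ∑ j, T (EuclideanSpace.single j 1) i * x j := fun x i => by
    have hx : T x = ∑ j, x j • T (EuclideanSpace.single j 1) := by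
      conv_lhs => rw [← (EuclideanSpace.basisFun κ ℂ).sum_repr x, map_sum]
      refine Finset.sum_congr rfl fun j _ => ?_
      rw [map_smul, EuclideanSpace.basisFun_repr, EuclideanSpace.basisFun_apply]
    rw [hx, WithLp.ofLp_sum, Finset.sum_apply]
    exact Finset.sum_congr rfl fun j _ => mul_comm _ _
  refine ⟨Matrix.of fun i j => T (EuclideanSpace.single j 1) i, fun x => ?_, fun i => ?_⟩
  · have := pow_le_pow_left₀ (norm_nonneg _) (hT (WithLp.toLp 2 x)) 2
    rw [EuclideanSpace.norm_sq_eq, EuclideanSpace.norm_sq_eq] at this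
    exact (Finset.sum_congr rfl fun i _ => congrArg (‖·‖ ^ 2) (hU _ i).symm).trans_le this
  · rw [← sub_eq_zero, ← Module.forall_dual_apply_eq_zero_iff ℂ]
    intro φ
    have := hU (β φ) i
    rw [hTβ, hα] at this
    simp only [hβ] at this
    rw [map_sub, this, map_sum, sub_eq_zero]
    exact Finset.sum_congr rfl fun j _ => (φ.map_smul _ _).symm

lemma isScalarContraction_one [DecidableEq ι] : IsScalarContraction (1 : Matrix ι ι ℂ) := by
  intro x
  simp [Matrix.one_apply]

lemma IsScalarContraction.submatrix_one {κ : Type} [Fintype κ] [DecidableEq ι] (e : κ ≃ ι) :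
    IsScalarContraction ((1 : Matrix ι ι ℂ).submatrix e id) := by
  intro x
  rw [← e.sum_comp fun j => ‖x j‖ ^ 2]
  simp [Matrix.one_apply]

lemma isScalarContraction_smul_one [DecidableEq ι] {c : ℂ} (hc : ‖c‖ ≤ 1) :
    IsScalarContraction (c • 1 : Matrix ι ι ℂ) := by
  intro x
  refine Finset.sum_le_sum fun i _ => ?_
  simp only [Matrix.smul_apply, Matrix.one_apply, smul_eq_mul, mul_ite, mul_one, mul_zero,
    ite_mul, zero_mul, Finset.sum_ite_eq, Finset.mem_univ, if_true, norm_mul, mul_pow]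
  exact mul_le_of_le_one_left (by positivity) (pow_le_one₀ (norm_nonneg c) hc)

lemma isScalarContraction_fromRows [DecidableEq ι] {a b : ℝ} (h : a ^ 2 + b ^ 2 ≤ 1) :
    IsScalarContraction (Matrix.fromRows ((a : ℂ) • 1) ((b : ℂ) • 1) :
      Matrix (ι ⊕ ι) ι ℂ) := by
  intro x
  simp only [Fintype.sum_sum_type, Matrix.fromRows_apply_inl, Matrix.fromRows_apply_inr,
    Matrix.smul_apply, Matrix.one_apply, smul_eq_mul, mul_ite, mul_one, mul_zero,
    ite_mul, zero_mul, Finset.sum_ite_eq, Finset.mem_univ, if_true, norm_mul, mul_pow,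
    Complex.norm_real, Real.norm_eq_abs, sq_abs, ← Finset.mul_sum, ← add_mul]
  exact mul_le_of_le_one_left (by positivity) h

lemma isScalarContraction_fromCols [DecidableEq ι] {a b : ℝ} (h : a ^ 2 + b ^ 2 ≤ 1) :
    IsScalarContraction (Matrix.fromCols ((a : ℂ) • 1) ((b : ℂ) • 1) :
      Matrix ι (ι ⊕ ι) ℂ) := by
  intro x
  simp only [Fintype.sum_sum_type, Matrix.fromCols_apply_inl, Matrix.fromCols_apply_inr,
    Matrix.smul_apply, Matrix.one_apply, smul_eq_mul, mul_ite, mul_one, mul_zero,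
    ite_mul, zero_mul, Finset.sum_ite_eq, Finset.mem_univ, if_true]
  rw [← Finset.sum_add_distrib]
  refine Finset.sum_le_sum fun i _ => ?_
  set u := ‖x (Sum.inl i)‖
  set v := ‖x (Sum.inr i)‖
  have h1 : ‖(a : ℂ) * x (Sum.inl i) + b * x (Sum.inr i)‖ ≤ |a| * u + |b| * v := by
    refine (norm_add_le _ _).trans ?_
    simp [u, v]
  refine (pow_le_pow_left₀ (norm_nonneg _) h1 2).trans ?_
  have h2 : |a| ^ 2 + |b| ^ 2 ≤ 1 := by simpa only [sq_abs] using h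
  nlinarith [sq_nonneg (|a| * v - |b| * u), sq_nonneg u, sq_nonneg v]

end ScalarContraction

/-! ### Matrix unit balls on an algebra -/

/-- The unit ball of an operator algebra structure (a compatible family of matrix seminorms) on a
complex unital algebra. -/
structure MatrixBall (𝒜 : Type*) [Ring 𝒜] [Algebra ℂ 𝒜] where
  /-- Membership of a matrix in the unit ball. -/
  Mem : ∀ {k l : Type} [Fintype k] [Fintype l], Matrix k l 𝒜 → Prop
  mul : ∀ {k l m : Type} [Fintype k] [Fintype l] [Fintype m] {A : Matrix k l 𝒜}
    {B : Matrix l m 𝒜}, Mem A → Mem B → Mem (A * B)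
  fromBlocks : ∀ {k l k' l' : Type} [Fintype k] [Fintype l] [Fintype k'] [Fintype l']
    {A : Matrix k l 𝒜} {B : Matrix k' l' 𝒜}, Mem A → Mem B → Mem (Matrix.fromBlocks A 0 0 B)
  scalar : ∀ {k l : Type} [Fintype k] [Fintype l] {α : Matrix k l ℂ},
    IsScalarContraction α → Mem (α.map (algebraMap ℂ 𝒜))
  exists_smul : ∀ {k l : Type} [Fintype k] [Fintype l] (A : Matrix k l 𝒜),
    ∃ c : ℝ, 0 < c ∧ Mem ((c : ℂ) • A)

namespace MatrixBall

variable {𝒜 : Type*} [Ring 𝒜] [Algebra ℂ 𝒜] (B : MatrixBall 𝒜)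
variable {k l m n k' : Type} [Fintype k] [Fintype l] [Fintype m] [Fintype n] [Fintype k']

lemma one [DecidableEq k] : B.Mem (1 : Matrix k k 𝒜) := by
  simpa using B.scalar (isScalarContraction_one (ι := k))

lemma map_smul_one [DecidableEq k] (c : ℂ) :
    ((c • 1 : Matrix k k ℂ).map (algebraMap ℂ 𝒜)) = c • (1 : Matrix k k 𝒜) := by
  ext i j
  rw [Matrix.map_apply, Matrix.smul_apply, Matrix.smul_apply]
  by_cases h : i = j <;> simp [h, Algebra.smul_def, Matrix.one_apply]

lemma smul {c : ℂ} (hc : ‖c‖ ≤ 1) {A : Matrix k l 𝒜} (hA : B.Mem A) : B.Mem (c • A) := by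
  classical
  convert B.mul (B.scalar (isScalarContraction_smul_one (ι := k) hc)) hA using 1
  rw [map_smul_one, Matrix.smul_mul, Matrix.one_mul]

/-- `B.NormLE A c` says that `A` lies in `c` times the unit ball. -/
def NormLE (A : Matrix k l 𝒜) (c : ℝ) : Prop := ∃ A', B.Mem A' ∧ A = (c : ℂ) • A'

variable {B}

lemma NormLE.mem_inv_smul {A : Matrix k l 𝒜} {c r : ℝ} (h : B.NormLE A c) (hc : 0 ≤ c)
    (hr : 0 < r) (hcr : c ≤ r) : B.Mem ((r : ℂ)⁻¹ • A) := by
  obtain ⟨A', hA', rfl⟩ := h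
  rw [smul_smul]
  refine B.smul ?_ hA'
  rw [norm_mul, norm_inv, Complex.norm_real, Complex.norm_real, Real.norm_of_nonneg hc,
    Real.norm_of_nonneg hr.le, inv_mul_le_iff₀ hr, mul_one]
  exact hcr

lemma NormLE.mul_left {A : Matrix k l 𝒜} {D : Matrix l m 𝒜} {c : ℝ} (hA : B.Mem A)
    (h : B.NormLE D c) : B.NormLE (A * D) c := by
  obtain ⟨D', hD', rfl⟩ := h
  exact ⟨A * D', B.mul hA hD', by simp⟩

lemma NormLE.submatrix_left {A : Matrix k l 𝒜} {c : ℝ} (h : B.NormLE A c) (e : k' ≃ k) :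
    B.NormLE (A.submatrix e id) c := by
  classical
  convert NormLE.mul_left (B.scalar (IsScalarContraction.submatrix_one e)) h using 1
  ext i j
  simp [Matrix.mul_apply, Matrix.one_apply, apply_ite (algebraMap ℂ 𝒜)]

lemma NormLE.fromRows_smul_one [DecidableEq l] {A : Matrix k l 𝒜} {c : ℝ} (h : B.NormLE A c)
    {s t : ℝ} (ht : 0 < t) (hst : s ^ 2 + c ^ 2 ≤ t ^ 2) :
    B.NormLE (Matrix.fromRows ((s : ℂ) • (1 : Matrix l l 𝒜)) A) t := by
  obtain ⟨A', hA', rfl⟩ := h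
  have hab : (s / t) ^ 2 + (c / t) ^ 2 ≤ 1 := by
    rw [div_pow, div_pow, ← add_div]
    exact (div_le_one (by positivity)).2 hst
  refine ⟨_, B.mul (B.fromBlocks (B.one (k := l)) hA')
    (B.scalar (isScalarContraction_fromRows hab)), ?_⟩
  have ht' : (t : ℂ) ≠ 0 := by exact_mod_cast ht.ne'
  have hmap : (Matrix.fromRows (((s / t : ℝ) : ℂ) • 1) (((c / t : ℝ) : ℂ) • 1) :
      Matrix (l ⊕ l) l ℂ).map (algebraMap ℂ 𝒜) =
      Matrix.fromRows (((s / t : ℝ) : ℂ) • 1) (((c / t : ℝ) : ℂ) • 1) := by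
    rw [← map_smul_one (𝒜 := 𝒜), ← map_smul_one (𝒜 := 𝒜)]
    ext (i | i) j <;> rfl
  rw [hmap, Matrix.fromBlocks_mul_fromRows]
  ext (i | i) j <;>
    simp only [Matrix.fromRows_apply_inl, Matrix.fromRows_apply_inr, Matrix.smul_apply,
      Matrix.mul_smul, Matrix.mul_one, add_zero, zero_add, smul_zero, smul_smul, Complex.ofReal_div, mul_div_cancel₀ _ ht']

lemma NormLE.fromRows_average {A : Matrix k n 𝒜} {D : Matrix l n 𝒜} {c x y z : ℝ}
    (hz : 0 < z) (hxyz : x ^ 2 + y ^ 2 = z ^ 2)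
    (h : B.NormLE (Matrix.fromRows (Matrix.fromRows ((x : ℂ) • A) ((y : ℂ) • A)) D) c) :
    B.NormLE (Matrix.fromRows ((z : ℂ) • A) D) c := by
  classical
  have hab : (x / z) ^ 2 + (y / z) ^ 2 ≤ 1 := by
    rw [div_pow, div_pow, ← add_div, hxyz, div_self (by positivity)]
  have hz' : (z : ℂ) ≠ 0 := by exact_mod_cast hz.ne'
  have hxyz' : (x : ℂ) ^ 2 + (y : ℂ) ^ 2 = (z : ℂ) ^ 2 := by exact_mod_cast hxyz
  convert NormLE.mul_left (B.fromBlocks (B.scalar (isScalarContraction_fromCols (ι := k) hab))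
    (B.one (k := l))) h using 1
  have hmap : (Matrix.fromCols (((x / z : ℝ) : ℂ) • 1) (((y / z : ℝ) : ℂ) • 1) :
      Matrix k (k ⊕ k) ℂ).map (algebraMap ℂ 𝒜) =
      Matrix.fromCols (((x / z : ℝ) : ℂ) • 1) (((y / z : ℝ) : ℂ) • 1) := by
    rw [← map_smul_one (𝒜 := 𝒜), ← map_smul_one (𝒜 := 𝒜)]
    ext i (j | j) <;> rfl
  have hz2 : (z : ℂ) = x / z * x + y / z * y := by
    field_simp
    rw [hxyz']
  rw [hmap, Matrix.fromBlocks_mul_fromRows, Matrix.fromCols_mul_fromRows]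
  ext (i | i) j
  · simp only [Matrix.fromRows_apply_inl, Matrix.smul_apply, Matrix.smul_mul,
      Matrix.one_mul, Matrix.zero_mul, add_zero, smul_smul, Complex.ofReal_div, ← add_smul, ← hz2]
  · simp

/-- If a column `(A; Y)` is a contractive multiple of `(s; Y)` then `A` has norm at most `s`. -/
lemma mem_inv_smul_of_fromRows_eq [DecidableEq n] {A : Matrix n n 𝒜} {Y : Matrix l n 𝒜}
    {M : Matrix (n ⊕ l) (n ⊕ l) 𝒜} (hM : B.Mem M) {s r : ℝ} (hs : 0 ≤ s) (hr : s < r)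
    (h : Matrix.fromRows A Y = M * Matrix.fromRows ((s : ℂ) • (1 : Matrix n n 𝒜)) Y) :
    B.Mem ((r : ℂ)⁻¹ • A) := by
  classical
  obtain ⟨c, hc, hY⟩ : ∃ c : ℝ, 0 < c ∧ B.NormLE (Matrix.fromRows A Y) c := by
    obtain ⟨c, hc, h⟩ := B.exists_smul (Matrix.fromRows A Y)
    refine ⟨c⁻¹, inv_pos.2 hc, _, h, ?_⟩
    have hc' : (c : ℂ) ≠ 0 := by exact_mod_cast hc.ne'
    rw [smul_smul, Complex.ofReal_inv, inv_mul_cancel₀ hc', one_smul]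
  have key : ∀ N : ℕ, B.NormLE (Matrix.fromRows (((√(N + 1) : ℝ) : ℂ) • A) Y)
      √(c ^ 2 + N * s ^ 2) := by
    intro N
    induction N with
    | zero => simpa [Real.sqrt_sq hc.le] using hY
    | succ N ih =>
      have h1 := ih.fromRows_smul_one (s := s) (t := √(c ^ 2 + (N + 1 : ℕ) * s ^ 2))
        (by positivity) (by
          rw [Real.sq_sqrt (by positivity), Real.sq_sqrt (by positivity)]
          push_cast
          linarith)
      let σ : n ⊕ n ⊕ l ≃ n ⊕ n ⊕ l := (Equiv.sumAssoc n n l).symm.trans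
        (((Equiv.sumComm n n).sumCongr (Equiv.refl l)).trans (Equiv.sumAssoc n n l))
      have h2 := (h1.submatrix_left σ).mul_left (B.fromBlocks (B.one (k := n)) hM)
      have hσ : (Matrix.fromRows ((s : ℂ) • (1 : Matrix n n 𝒜))
          (Matrix.fromRows (((√(N + 1) : ℝ) : ℂ) • A) Y)).submatrix σ id =
          Matrix.fromRows (((√(N + 1) : ℝ) : ℂ) • A)
            (Matrix.fromRows ((s : ℂ) • (1 : Matrix n n 𝒜)) Y) := by
        ext (i | i | i) j <;> rfl
      rw [hσ, Matrix.fromBlocks_mul_fromRows, ← h, Matrix.one_mul, Matrix.zero_mul,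
        Matrix.zero_mul, add_zero, zero_add] at h2
      refine NormLE.fromRows_average (x := √(N + 1)) (y := 1) (by positivity) ?_ ?_
      · rw [Real.sq_sqrt (by positivity), Real.sq_sqrt (by positivity)]
        push_cast
        ring
      · convert h2.submatrix_left (Equiv.sumAssoc n n l) using 1
        ext ((i | i) | i) j <;> simp
  have hlim : Filter.Tendsto (fun N : ℕ => √((c ^ 2 + N * s ^ 2) / (N + 1))) Filter.atTop
      (nhds s) := by
    have h0 := tendsto_one_div_add_atTop_nhds_zero_nat (𝕜 := ℝ)
    have h1 := ((h0.const_mul (c ^ 2 - s ^ 2)).const_add (s ^ 2)).sqrt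
    rw [mul_zero, add_zero, Real.sqrt_sq hs] at h1
    refine h1.congr fun N => congrArg _ ?_
    field_simp
    ring
  obtain ⟨N, hN⟩ := (hlim.eventually_lt_const hr).exists
  have hr0 : 0 < r := hs.trans_lt hr
  have hproj : IsScalarContraction (Matrix.fromCols 1 0 : Matrix n (n ⊕ l) ℂ) := fun x => by
    simp [Fintype.sum_sum_type, Matrix.one_apply]
    positivity
  have h3 := (key N).mul_left (B.scalar hproj)
  have hp : (Matrix.fromCols 1 0 : Matrix n (n ⊕ l) ℂ).map (algebraMap ℂ 𝒜) =
      Matrix.fromCols 1 0 := by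
    ext i (j | j) <;> simp [Matrix.one_apply, apply_ite (algebraMap ℂ 𝒜)]
  rw [hp, Matrix.fromCols_mul_fromRows, Matrix.one_mul, Matrix.zero_mul, add_zero] at h3
  have h4 := h3.mem_inv_smul (r := √(N + 1) * r) (by positivity) (by positivity) (by
    rw [Real.sqrt_div (by positivity), div_lt_iff₀ (by positivity)] at hN
    exact hN.le.trans_eq (mul_comm _ _))
  convert h4 using 1
  have hN0 : ((√(N + 1) : ℝ) : ℂ) ≠ 0 := by
    have : 0 < √((N : ℝ) + 1) := by positivity
    exact_mod_cast this.ne'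
  rw [smul_smul]
  congr 1
  push_cast
  field_simp

/-- If a quadratic form inequality certifies that `A` is bounded by `s`, then it is. -/
lemma mem_inv_smul_of_dual_le [DecidableEq n] {Z : Matrix k l 𝒜} (hZ : B.Mem Z)
    (Y : Matrix l n 𝒜) (A : Matrix n n 𝒜) {s r : ℝ} (hs : 0 ≤ s) (hr : s < r)
    (h : ∀ φ : Module.Dual ℂ (n → 𝒜), ∑ i, ‖φ (Y i)‖ ^ 2 + ∑ i, ‖φ (A i)‖ ^ 2 ≤
      s ^ 2 * ∑ i, ‖φ ((1 : Matrix n n 𝒜) i)‖ ^ 2 + ∑ i, ‖φ ((Z * Y) i)‖ ^ 2) :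
    B.Mem ((r : ℂ)⁻¹ • A) := by
  classical
  obtain ⟨U, hU, hUeq⟩ := exists_isScalarContraction_of_dual_le (E := n → 𝒜)
    (Sum.elim A Y) (Sum.elim ((s : ℂ) • (1 : Matrix n n 𝒜)) (Z * Y)) (fun φ => by
      have := h φ
      rw [Fintype.sum_sum_type, Fintype.sum_sum_type]
      change ∑ i, ‖φ (A i)‖ ^ 2 + ∑ i, ‖φ (Y i)‖ ^ 2 ≤
        ∑ i, ‖φ (((s : ℂ) • (1 : Matrix n n 𝒜)) i)‖ ^ 2 + ∑ i, ‖φ ((Z * Y) i)‖ ^ 2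
      have h2 : ∀ i, φ (((s : ℂ) • (1 : Matrix n n 𝒜)) i) = s * φ ((1 : Matrix n n 𝒜) i) :=
        fun i => φ.map_smul _ _
      simp only [h2, norm_mul, mul_pow, Complex.norm_real, Real.norm_eq_abs, sq_abs,
        ← Finset.mul_sum]
      linarith)
  refine mem_inv_smul_of_fromRows_eq (Y := Y)
    (B.mul (B.scalar hU) (B.fromBlocks (B.one (k := n)) hZ)) hs hr ?_
  rw [Matrix.mul_assoc, Matrix.fromBlocks_mul_fromRows, Matrix.one_mul, Matrix.zero_mul,
    Matrix.zero_mul, add_zero, zero_add]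
  ext i j
  have h1 := congrFun (hUeq i) j
  have h2 : Matrix.fromRows A Y i j = Sum.elim A Y i j := by rcases i with i | i <;> rfl
  rw [h2, h1, Finset.sum_apply, Matrix.mul_apply]
  refine Finset.sum_congr rfl fun x _ => ?_
  rw [Pi.smul_apply, Matrix.map_apply, Algebra.smul_def]
  rcases x with x | x <;> rfl

end MatrixBall

/-! ### Separating functionals -/

/-- The quadratic function `φ ↦ ∑ᵢ |φ(Yᵢ)|²` attached to the rows of a matrix. -/
def rowSqSum {𝒜 : Type*} [Ring 𝒜] [Algebra ℂ 𝒜] {l n : Type} [Fintype l] (Y : Matrix l n 𝒜)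
    (φ : Module.Dual ℂ (n → 𝒜)) : ℝ := ∑ i, ‖φ (Y i)‖ ^ 2

namespace MatrixBall

variable {𝒜 : Type*} [Ring 𝒜] [Algebra ℂ 𝒜] {B : MatrixBall 𝒜}
variable {k l m n : Type} [Fintype k] [Fintype l] [Fintype m] [Fintype n]

lemma rowSqSum_nonneg (Y : Matrix l n 𝒜) : 0 ≤ rowSqSum Y := fun _ =>
  Finset.sum_nonneg fun _ _ => sq_nonneg _

lemma rowSqSum_smul (c : ℂ) (Y : Matrix l n 𝒜) : rowSqSum (c • Y) = ‖c‖ ^ 2 • rowSqSum Y := by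
  ext φ
  have h : ∀ i, φ ((c • Y) i) = c * φ (Y i) := fun i => φ.map_smul _ _
  simp [rowSqSum, h, mul_pow, Finset.mul_sum]

lemma rowSqSum_fromRows (Y : Matrix k n 𝒜) (Y' : Matrix l n 𝒜) :
    rowSqSum (Matrix.fromRows Y Y') = rowSqSum Y + rowSqSum Y' := by
  ext φ
  exact Fintype.sum_sum_type _

variable (B n) in
/-- The convex cone of functions dominating a difference `∑ᵢ |φ(Yᵢ)|² - ∑ᵢ |φ((ZY)ᵢ)|²` with `Z` in
the unit ball. -/
def cone : PointedCone ℝ (Module.Dual ℂ (n → 𝒜) → ℝ) where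
  carrier := {u | ∃ (k l : Type) (_ : Fintype k) (_ : Fintype l) (Z : Matrix k l 𝒜)
    (Y : Matrix l n 𝒜), B.Mem Z ∧ rowSqSum Y - rowSqSum (Z * Y) ≤ u}
  zero_mem' := by
    refine ⟨PEmpty, PEmpty, inferInstance, inferInstance, 1, 0, B.one, ?_⟩
    rw [Matrix.mul_zero, sub_self]
  add_mem' := by
    rintro u v ⟨k, l, _, _, Z, Y, hZ, hu⟩ ⟨k', l', _, _, Z', Y', hZ', hv⟩
    refine ⟨k ⊕ k', l ⊕ l', inferInstance, inferInstance, Matrix.fromBlocks Z 0 0 Z',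
      Matrix.fromRows Y Y', B.fromBlocks hZ hZ', ?_⟩
    rw [Matrix.fromBlocks_mul_fromRows, rowSqSum_fromRows, rowSqSum_fromRows, Matrix.zero_mul,
      Matrix.zero_mul, add_zero, zero_add, add_sub_add_comm]
    exact add_le_add hu hv
  smul_mem' := by
    rintro c u ⟨k, l, _, _, Z, Y, hZ, hu⟩
    refine ⟨k, l, inferInstance, inferInstance, Z, ((√(c : ℝ) : ℝ) : ℂ) • Y, hZ, ?_⟩
    rw [Matrix.mul_smul, rowSqSum_smul, rowSqSum_smul, ← smul_sub, Complex.norm_real,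
      Real.norm_of_nonneg (Real.sqrt_nonneg _), Real.sq_sqrt c.2]
    exact smul_le_smul_of_nonneg_left hu c.2

lemma mem_cone_of_le {u v : Module.Dual ℂ (n → 𝒜) → ℝ} (hu : u ∈ B.cone n) (h : u ≤ v) :
    v ∈ B.cone n := by
  obtain ⟨k, l, _, _, Z, Y, hZ, hu⟩ := hu
  exact ⟨k, l, inferInstance, inferInstance, Z, Y, hZ, hu.trans h⟩

lemma mem_cone_of_nonneg {u : Module.Dual ℂ (n → 𝒜) → ℝ} (h : 0 ≤ u) : u ∈ B.cone n :=
  mem_cone_of_le (B.cone n).zero_mem h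

lemma sub_mem_cone {Z : Matrix k l 𝒜} (hZ : B.Mem Z) (Y : Matrix l n 𝒜) :
    rowSqSum Y - rowSqSum (Z * Y) ∈ B.cone n :=
  ⟨k, l, inferInstance, inferInstance, Z, Y, hZ, le_rfl⟩

lemma smul_mem_cone {u : Module.Dual ℂ (n → 𝒜) → ℝ} (hu : u ∈ B.cone n) {c : ℝ} (hc : 0 ≤ c) :
    c • u ∈ B.cone n :=
  (B.cone n).smul_mem hc hu

lemma exists_sub_mem_cone [DecidableEq n] (X : Matrix k n 𝒜) :
    ∃ t : ℝ, t • rowSqSum (1 : Matrix n n 𝒜) - rowSqSum X ∈ B.cone n := by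
  obtain ⟨c, hc, hX⟩ := B.exists_smul X
  refine ⟨(c ^ 2)⁻¹, ?_⟩
  convert smul_mem_cone (sub_mem_cone hX 1) (c := (c ^ 2)⁻¹) (by positivity) using 1
  rw [Matrix.mul_one, rowSqSum_smul, smul_sub, smul_smul, Complex.norm_real,
    Real.norm_of_nonneg hc.le, inv_mul_cancel₀ (by positivity), one_smul]

lemma sq_le_of_mem_cone [DecidableEq n] {A : Matrix n n 𝒜} {r t : ℝ} (hr : 0 < r)
    (hA : ¬ B.Mem ((r : ℂ)⁻¹ • A))
    (h : t • rowSqSum (1 : Matrix n n 𝒜) - rowSqSum A ∈ B.cone n) : r ^ 2 ≤ t := by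
  by_contra! ht
  obtain ⟨k, l, _, _, Z, Y, hZ, h⟩ := h
  refine hA (mem_inv_smul_of_dual_le hZ Y A (Real.sqrt_nonneg t) ?_ fun φ => ?_)
  · exact (Real.sqrt_lt' hr).2 ht
  · have h1 : rowSqSum Y φ - rowSqSum (Z * Y) φ ≤
      t * rowSqSum (1 : Matrix n n 𝒜) φ - rowSqSum A φ := h φ
    have h2 : t * rowSqSum (1 : Matrix n n 𝒜) φ ≤ √t ^ 2 * rowSqSum (1 : Matrix n n 𝒜) φ := by
      refine mul_le_mul_of_nonneg_right ?_ (rowSqSum_nonneg _ φ)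
      rcases le_total 0 t with h0 | h0
      · rw [Real.sq_sqrt h0]
      · exact h0.trans (sq_nonneg _)
    change rowSqSum Y φ + rowSqSum A φ ≤
      √t ^ 2 * rowSqSum (1 : Matrix n n 𝒜) φ + rowSqSum (Z * Y) φ
    linarith

variable (B n) in
/-- The functions which are order bounded by a multiple of the function of the identity matrix. -/
def bounded [DecidableEq n] : Submodule ℝ (Module.Dual ℂ (n → 𝒜) → ℝ) where
  carrier := {u | ∃ t : ℝ, t • rowSqSum (1 : Matrix n n 𝒜) - u ∈ B.cone n ∧
    t • rowSqSum (1 : Matrix n n 𝒜) + u ∈ B.cone n}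
  zero_mem' := ⟨0, by simp, by simp⟩
  add_mem' := by
    rintro u v ⟨t, hu, hu'⟩ ⟨t', hv, hv'⟩
    refine ⟨t + t', ?_, ?_⟩
    · convert (B.cone n).add_mem hu hv using 1
      module
    · convert (B.cone n).add_mem hu' hv' using 1
      module
  smul_mem' := by
    rintro c u ⟨t, hu, hu'⟩
    rcases le_total 0 c with hc | hc
    · refine ⟨c * t, ?_, ?_⟩
      · convert smul_mem_cone hu hc using 1
        module
      · convert smul_mem_cone hu' hc using 1
        module
    · refine ⟨-c * t, ?_, ?_⟩
      · convert smul_mem_cone hu' (neg_nonneg.2 hc) using 1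
        module
      · convert smul_mem_cone hu (neg_nonneg.2 hc) using 1
        module

lemma rowSqSum_mem_bounded [DecidableEq n] (X : Matrix k n 𝒜) : rowSqSum X ∈ B.bounded n := by
  obtain ⟨t, ht⟩ := exists_sub_mem_cone (B := B) X
  refine ⟨|t|, mem_cone_of_le ht ?_, mem_cone_of_nonneg ?_⟩
  · exact sub_le_sub_right (smul_le_smul_of_nonneg_right (le_abs_self t) (rowSqSum_nonneg _)) _
  · exact add_nonneg (smul_nonneg (abs_nonneg t) (rowSqSum_nonneg _)) (rowSqSum_nonneg _)

/-- A matrix outside of `r` times the unit ball is separated from it by a functional which is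
positive on the cone of the ball. -/
lemma exists_functional [DecidableEq n] {A : Matrix n n 𝒜} {r : ℝ} (hr : 0 < r)
    (hA : ¬ B.Mem ((r : ℂ)⁻¹ • A)) :
    ∃ h : (Module.Dual ℂ (n → 𝒜) → ℝ) →ₗ[ℝ] ℝ,
      (∀ (k l : Type) [Fintype k] [Fintype l] (Z : Matrix k l 𝒜) (Y : Matrix l n 𝒜), B.Mem Z →
        h (rowSqSum (Z * Y)) ≤ h (rowSqSum Y)) ∧
      (∀ x : n → 𝒜, 0 ≤ h fun φ => ‖φ x‖ ^ 2) ∧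
      h (rowSqSum (1 : Matrix n n 𝒜)) = 1 ∧ r ^ 2 ≤ h (rowSqSum A) := by
  let ω : B.bounded n := ⟨rowSqSum (1 : Matrix n n 𝒜), rowSqSum_mem_bounded (1 : Matrix n n 𝒜)⟩
  let a : B.bounded n := ⟨rowSqSum A, rowSqSum_mem_bounded A⟩
  have hneg : ∀ c : ℝ, c • rowSqSum (1 : Matrix n n 𝒜) ∈ B.cone n → 0 ≤ c := by
    intro c hc
    by_contra! hc0
    obtain ⟨t, ht⟩ := exists_sub_mem_cone (B := B) A
    have h1 := (B.cone n).add_mem ht (smul_mem_cone hc (c := |t| / (-c))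
      (div_nonneg (abs_nonneg t) (neg_pos.2 hc0).le))
    have h2 : (t - |t|) • rowSqSum (1 : Matrix n n 𝒜) - rowSqSum A ∈ B.cone n := by
      convert h1 using 1
      rw [smul_smul, div_neg, neg_mul, div_mul_cancel₀ _ hc0.ne]
      module
    have h3 := sq_le_of_mem_cone hr hA h2
    have h4 := le_abs_self t
    have h5 : 0 < r ^ 2 := by positivity
    linarith
  have hω : ω ≠ 0 := by
    intro h0
    have h0' : rowSqSum (1 : Matrix n n 𝒜) = 0 := congrArg Subtype.val h0
    have := hneg (-1) (by rw [h0', smul_zero]; exact (B.cone n).zero_mem)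
    linarith
  let s : PointedCone ℝ (B.bounded n) :=
    { carrier := {u | ∃ c : ℝ, 0 ≤ c ∧
        (u : Module.Dual ℂ (n → 𝒜) → ℝ) - c • (rowSqSum A - r ^ 2 • rowSqSum (1 : Matrix n n 𝒜)) ∈ B.cone n}
      zero_mem' := ⟨0, le_rfl, by simp⟩
      add_mem' := by
        rintro u v ⟨c, hc, hu⟩ ⟨d, hd, hv⟩
        refine ⟨c + d, add_nonneg hc hd, ?_⟩
        convert (B.cone n).add_mem hu hv using 1
        rw [Submodule.coe_add]
        module
      smul_mem' := by
        rintro ⟨d, hd⟩ u ⟨c, hc, hu⟩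
        refine ⟨d * c, mul_nonneg hd hc, ?_⟩
        convert smul_mem_cone hu hd using 1
        change d • (u : Module.Dual ℂ (n → 𝒜) → ℝ) - _ = _
        module }
  let f : B.bounded n →ₗ.[ℝ] ℝ := LinearPMap.mkSpanSingleton ω (1 : ℝ) hω
  have hfω : ∀ c : ℝ, ∀ hx, f ⟨c • ω, hx⟩ = c := fun c hx => by
    rw [LinearPMap.mkSpanSingleton'_apply]
    simp
  obtain ⟨g, hg, hgs⟩ := riesz_extension s f (by
    rintro ⟨x, hx⟩ hxs
    obtain ⟨c, rfl⟩ := Submodule.mem_span_singleton.1 hx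
    rw [hfω]
    obtain ⟨d, hd, hxs⟩ := hxs
    rcases hd.eq_or_lt with rfl | hd
    · exact hneg c (by simpa using hxs)
    · have h1 := smul_mem_cone hxs (inv_nonneg.2 hd.le)
      have h2 : (c / d + r ^ 2) • rowSqSum (1 : Matrix n n 𝒜) - rowSqSum A ∈ B.cone n := by
        convert h1 using 1
        change _ = d⁻¹ • (c • rowSqSum (1 : Matrix n n 𝒜) - _)
        rw [smul_sub, smul_smul, smul_smul, inv_mul_cancel₀ hd.ne', one_smul, div_eq_inv_mul]
        module
      have h3 := sq_le_of_mem_cone hr hA h2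
      have h4 : 0 ≤ c / d := by linarith
      simpa [hd] using (le_div_iff₀ hd).1 h4) (by
    rintro ⟨u, t, hu, hu'⟩
    refine ⟨⟨t • ω, Submodule.mem_span_singleton.2 ⟨t, rfl⟩⟩, 0, le_rfl, ?_⟩
    rw [zero_smul, sub_zero]
    exact hu')
  obtain ⟨h, hh⟩ := LinearMap.exists_extend g
  have hh' : ∀ u : B.bounded n, h u = g u := fun u => LinearMap.congr_fun hh u
  have hpos : ∀ u ∈ B.cone n, u ∈ B.bounded n → 0 ≤ h u := fun u hu hu' => by
    rw [hh' ⟨u, hu'⟩]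
    exact hgs _ ⟨0, le_rfl, by simpa using hu⟩
  have hone : h (rowSqSum (1 : Matrix n n 𝒜)) = 1 := by
    have h1 : g ((1 : ℝ) • ω) = 1 :=
      (hg ⟨(1 : ℝ) • ω, Submodule.mem_span_singleton.2 ⟨1, rfl⟩⟩).trans (hfω 1 _)
    rw [one_smul] at h1
    exact (hh' ω).trans h1
  refine ⟨h, fun k l _ _ Z Y hZ => ?_, fun x => ?_, hone, ?_⟩
  · have := hpos _ (sub_mem_cone hZ Y)
      ((B.bounded n).sub_mem (rowSqSum_mem_bounded Y) (rowSqSum_mem_bounded _))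
    rwa [map_sub, sub_nonneg] at this
  · have h1 : (fun φ : Module.Dual ℂ (n → 𝒜) => ‖φ x‖ ^ 2) =
        rowSqSum (Matrix.of fun _ : Unit => x) := by
      ext φ
      simp [rowSqSum]
      rfl
    rw [h1]
    exact hpos _ (mem_cone_of_nonneg (rowSqSum_nonneg _)) (rowSqSum_mem_bounded _)
  · have h1 : 0 ≤ g (a - r ^ 2 • ω) := hgs _ ⟨1, zero_le_one, by
      rw [one_smul]
      convert (B.cone n).zero_mem
      exact sub_self _⟩
    rw [← hh'] at h1
    change 0 ≤ h (rowSqSum A - r ^ 2 • rowSqSum (1 : Matrix n n 𝒜)) at h1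
    rw [map_sub, map_smul, hone] at h1
    simpa using h1

end MatrixBall

/-! ### The Gelfand-Naimark-Segal construction -/

/-- A positive semidefinite form on a complex vector space comes from a map into a Hilbert space. -/
lemma exists_hilbert_of_core {E : Type} [AddCommGroup E] [Module ℂ E]
    (c : PreInnerProductSpace.Core ℂ E) :
    ∃ (K : Type) (_ : NormedAddCommGroup K) (_ : InnerProductSpace ℂ K) (_ : CompleteSpace K)
      (ι : E →ₗ[ℂ] K), DenseRange ι ∧ ∀ x, ‖ι x‖ ^ 2 = (c.inner x x).re := by
  let _ : SeminormedAddCommGroup E := InnerProductSpace.Core.toSeminormedAddCommGroup (c := c)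
  let _ : InnerProductSpace ℂ E := InnerProductSpace.ofCore c
  refine ⟨UniformSpace.Completion E, inferInstance, inferInstance, inferInstance,
    UniformSpace.Completion.toComplL.toLinearMap, UniformSpace.Completion.denseRange_coe,
    fun x => ?_⟩
  have h : ‖(x : UniformSpace.Completion E)‖ ^ 2 = (inner ℂ x x).re := by
    rw [UniformSpace.Completion.norm_coe]
    exact norm_sq_eq_re_inner (𝕜 := ℂ) x
  exact h

/-- A positive functional on functions on the dual space induces a positive semidefinite form. -/
@[reducible] def coreOfFunctional {E : Type} [AddCommGroup E] [Module ℂ E]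
    (h : (Module.Dual ℂ E → ℝ) →ₗ[ℝ] ℝ) (hpos : ∀ x : E, 0 ≤ h fun φ => ‖φ x‖ ^ 2) :
    PreInnerProductSpace.Core ℂ E where
  inner x y := ⟨h fun φ => (star (φ x) * φ y).re, h fun φ => (star (φ x) * φ y).im⟩
  conj_inner_symm x y := by
    apply Complex.ext
    · exact congrArg h (funext fun φ => by simp; ring)
    · rw [Complex.conj_im, ← map_neg]
      exact congrArg h (funext fun φ => by simp; ring)
  re_inner_nonneg x := by
    refine (hpos x).trans_eq (congrArg h (funext fun φ => ?_))
    rw [← Complex.normSq_eq_norm_sq, Complex.normSq_apply]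
    simp
  add_left x y z := by
    apply Complex.ext
    · rw [Complex.add_re, ← map_add]
      exact congrArg h (funext fun φ => by simp; ring)
    · rw [Complex.add_im, ← map_add]
      exact congrArg h (funext fun φ => by simp; ring)
  smul_left x y r := by
    apply Complex.ext
    · rw [Complex.mul_re, ← smul_eq_mul, ← smul_eq_mul, ← map_smul, ← map_smul, ← map_sub]
      exact congrArg h (funext fun φ => by simp; ring)
    · rw [Complex.mul_im, ← smul_eq_mul, ← smul_eq_mul, ← map_smul, ← map_smul, ← map_add]
      exact congrArg h (funext fun φ => by simp; ring)

namespace MatrixBall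

variable {𝒜 : Type} [Ring 𝒜] [Algebra ℂ 𝒜] {B : MatrixBall 𝒜} {n : Type} [Fintype n]

/-- A matrix outside of `r` times the unit ball has norm at least `r` in some representation which
is contractive on the unit ball. -/
lemma exists_representation [DecidableEq n] {A : Matrix n n 𝒜} {r : ℝ} (hr : 0 < r)
    (hA : ¬ B.Mem ((r : ℂ)⁻¹ • A)) :
    ∃ (K : Type) (_ : NormedAddCommGroup K) (_ : InnerProductSpace ℂ K) (_ : CompleteSpace K)
      (π : 𝒜 →ₗ[ℂ] (K →L[ℂ] K)), π 1 = 1 ∧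
      (∀ (k l : Type) [Fintype k] [Fintype l] (Z : Matrix k l 𝒜), B.Mem Z →
        opMatNorm (Z.map π) ≤ 1) ∧ r ≤ opMatNorm (A.map π) := by
  obtain ⟨h, hball, hpos, hone, hrA⟩ := exists_functional hr hA
  obtain ⟨K, _, _, _, ι, hι, hnorm⟩ := exists_hilbert_of_core (coreOfFunctional h hpos)
  have hnorm' : ∀ x, ‖ι x‖ ^ 2 = h fun φ => ‖φ x‖ ^ 2 := fun x => by
    rw [hnorm]
    refine congrArg h (funext fun φ => ?_)
    rw [← Complex.normSq_eq_norm_sq, Complex.normSq_apply]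
    simp
  have hsum : ∀ {l : Type} [Fintype l] (Y : Matrix l n 𝒜),
      ∑ i, ‖ι (Y i)‖ ^ 2 = h (rowSqSum Y) := fun Y => by
    simp only [hnorm']
    rw [← map_sum]
    refine congrArg h (funext fun φ => ?_)
    simp [rowSqSum]
  have hbound : ∀ a : 𝒜, ∃ C, ∀ x, ‖(ι ∘ₗ Algebra.lsmul ℂ ℂ (n → 𝒜) a) x‖ ≤ C * ‖ι x‖ := by
    intro a
    obtain ⟨c, hc, hmem⟩ := B.exists_smul (Matrix.of fun _ _ : Unit => a)
    refine ⟨c⁻¹, fun x => ?_⟩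
    have h1 := hball _ _ _ (Matrix.of fun _ : Unit => x) hmem
    rw [← hsum, ← hsum] at h1
    have h2 : ((((c : ℂ) • Matrix.of fun _ _ : Unit => a) * Matrix.of fun _ : Unit => x :
        Matrix Unit n 𝒜) ()) = (c : ℂ) • (a • x) := by
      ext j
      simp [Matrix.mul_apply]
    simp only [Finset.univ_unique, Finset.sum_singleton] at h1
    change ‖ι ((((c : ℂ) • Matrix.of fun _ _ : Unit => a) * Matrix.of fun _ : Unit => x :
        Matrix Unit n 𝒜) ())‖ ^ 2 ≤ ‖ι x‖ ^ 2 at h1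
    rw [h2, map_smul, norm_smul, Complex.norm_real, Real.norm_of_nonneg hc.le] at h1
    rw [← div_eq_inv_mul, le_div_iff₀ hc, mul_comm]
    exact le_of_sq_le_sq h1 (norm_nonneg _)
  have hext : ∀ (S T : K →L[ℂ] K), (∀ x, S (ι x) = T (ι x)) → S = T := fun S T hST =>
    ContinuousLinearMap.coeFn_injective
      (hι.equalizer S.continuous T.continuous (funext hST))
  let π₀ : 𝒜 → (K →L[ℂ] K) := fun a => (ι ∘ₗ Algebra.lsmul ℂ ℂ (n → 𝒜) a).extendOfNorm ι
  have hπ₀ : ∀ a x, π₀ a (ι x) = ι (a • x) := fun a x =>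
    LinearMap.extendOfNorm_eq hι (hbound a) x
  let π : 𝒜 →ₗ[ℂ] (K →L[ℂ] K) :=
    { toFun := π₀
      map_add' := fun a b => hext _ _ fun x => by simp [hπ₀, add_smul]
      map_smul' := fun c a => hext _ _ fun x => by simp [hπ₀] }
  have hπ : ∀ a x, π a (ι x) = ι (a • x) := hπ₀
  have hmul : ∀ {k l : Type} [Fintype k] [Fintype l] (Z : Matrix k l 𝒜) (Y : Matrix l n 𝒜) i,
      ∑ j, (Z.map π) i j (ι (Y j)) = ι ((Z * Y) i) := fun Z Y i => by
    simp only [Matrix.map_apply, hπ]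
    rw [← map_sum]
    congr 1
    ext j
    simp [Matrix.mul_apply]
  refine ⟨K, ‹_›, ‹_›, ‹_›, π, hext (π 1) 1 fun x => by rw [hπ, one_smul]; rfl, fun k l _ _ Z hZ => ?_, ?_⟩
  · rw [opMatNorm_le_one_iff]
    intro y
    have hd : DenseRange (Pi.map fun _ : l => (ι : (n → 𝒜) → K)) := DenseRange.piMap fun _ => hι
    refine hd.induction_on
      (p := fun y : l → K => ∑ i, ‖∑ j, (Z.map π) i j (y j)‖ ^ 2 ≤ ∑ j, ‖y j‖ ^ 2) y ?_ fun Y => ?_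
    · exact isClosed_le (by fun_prop) (by fun_prop)
    · have h1 := hball _ _ Z (Matrix.of Y) hZ
      rw [← hsum, ← hsum] at h1
      simp only [← hmul] at h1
      exact h1
  · have h1 := sum_norm_sq_le_opMatNorm (A.map π) fun j => ι ((1 : Matrix n n 𝒜) j)
    simp only [hmul, Matrix.mul_one] at h1
    rw [hsum, hsum, hone, mul_one] at h1
    exact le_of_sq_le_sq (hrA.trans h1) (opMatNorm_nonneg _)

end MatrixBall

/-! ### The unit ball of the factorization norms -/

/-- Finite products `f(X⁽¹⁾) ⋯ f(X⁽ᴺ⁾)` of matrices `X⁽ⁱ⁾` over `V` of norm at most one. -/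
inductive FactorizationBall {V : Submodule ℂ (H →L[ℂ] H)} {𝒜 : Type*} [Ring 𝒜] [Algebra ℂ 𝒜]
    (f : ↥V →ₗ[ℂ] 𝒜) : ∀ {k l : Type} [Fintype k] [Fintype l], Matrix k l 𝒜 → Prop
  | single {k l : Type} [Fintype k] [Fintype l] (X : Matrix k l ↥V) (hX : subMatNorm X ≤ 1) :
    FactorizationBall f (X.map f)
  | cons {k d l : Type} [Fintype k] [Fintype d] [Fintype l] (X : Matrix k d ↥V)
    (Z : Matrix d l 𝒜) (hX : subMatNorm X ≤ 1) (hZ : FactorizationBall f Z) :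
    FactorizationBall f (X.map f * Z)

namespace FactorizationBall

variable {V : Submodule ℂ (H →L[ℂ] H)} {𝒜 : Type*} [Ring 𝒜] [Algebra ℂ 𝒜] {f : ↥V →ₗ[ℂ] 𝒜}
variable {k l m k' l' : Type} [Fintype k] [Fintype l] [Fintype m] [Fintype k'] [Fintype l']

lemma subMatNorm_smul_unit_le {e : ↥V} (he : ‖(e : H →L[ℂ] H)‖ = 1) {α : Matrix k l ℂ}
    (hα : IsScalarContraction α) : subMatNorm (α.map fun c => c • e) ≤ 1 :=
  hα.opMatNorm_le_one he.le

lemma subMatNorm_fromBlocks_le {X : Matrix k l ↥V} {Y : Matrix k' l' ↥V} (hX : subMatNorm X ≤ 1)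
    (hY : subMatNorm Y ≤ 1) : subMatNorm (Matrix.fromBlocks X 0 0 Y) ≤ 1 := by
  have h := opMatNorm_fromBlocks_le_one hX hY
  rw [subMatNorm, Matrix.fromBlocks_map]
  convert h using 2
  all_goals ext; simp

lemma mul {A : Matrix k l 𝒜} {D : Matrix l m 𝒜} (hA : FactorizationBall f A)
    (hD : FactorizationBall f D) : FactorizationBall f (A * D) := by
  induction hA with
  | single X hX => exact cons X D hX hD
  | cons X Z hX _ ih =>
    rw [Matrix.mul_assoc]
    exact cons X _ hX (ih hD)

lemma scalar {e : ↥V} (he : ‖(e : H →L[ℂ] H)‖ = 1) (hf : f e = 1) {α : Matrix k l ℂ}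
    (hα : IsScalarContraction α) : FactorizationBall f (α.map (algebraMap ℂ 𝒜)) := by
  convert single (f := f) _ (subMatNorm_smul_unit_le he hα) using 1
  ext i j
  simp [hf, Algebra.algebraMap_eq_smul_one]

lemma map_unit [DecidableEq k] {e : ↥V} (hf : f e = 1) :
    ((1 : Matrix k k ℂ).map fun c => c • e).map f = 1 := by
  ext i j
  by_cases h : i = j <;> simp [h, hf, Matrix.one_apply]

lemma map_fromBlocks (X : Matrix k l ↥V) (Y : Matrix k' l' ↥V) :
    (Matrix.fromBlocks X 0 0 Y).map f = Matrix.fromBlocks (X.map f) 0 0 (Y.map f) := by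
  rw [Matrix.fromBlocks_map]
  congr 1 <;> ext <;> simp

lemma fromBlocks_one [DecidableEq m] {e : ↥V} (he : ‖(e : H →L[ℂ] H)‖ = 1) (hf : f e = 1)
    {A : Matrix k l 𝒜} (hA : FactorizationBall f A) :
    FactorizationBall f (Matrix.fromBlocks A 0 0 (1 : Matrix m m 𝒜)) := by
  have h1 := subMatNorm_smul_unit_le he (isScalarContraction_one (ι := m))
  induction hA with
  | single X hX =>
    rw [← map_unit hf, ← map_fromBlocks]
    exact single _ (subMatNorm_fromBlocks_le hX h1)
  | cons X Z hX _ ih =>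
    convert cons _ _ (subMatNorm_fromBlocks_le hX h1) ih using 1
    rw [map_fromBlocks, map_unit hf, Matrix.fromBlocks_multiply]
    simp

lemma one_fromBlocks [DecidableEq m] {e : ↥V} (he : ‖(e : H →L[ℂ] H)‖ = 1) (hf : f e = 1)
    {A : Matrix k l 𝒜} (hA : FactorizationBall f A) :
    FactorizationBall f (Matrix.fromBlocks (1 : Matrix m m 𝒜) 0 0 A) := by
  have h1 := subMatNorm_smul_unit_le he (isScalarContraction_one (ι := m))
  induction hA with
  | single X hX =>
    rw [← map_unit hf, ← map_fromBlocks]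
    exact single _ (subMatNorm_fromBlocks_le h1 hX)
  | cons X Z hX _ ih =>
    convert cons _ _ (subMatNorm_fromBlocks_le h1 hX) ih using 1
    rw [map_fromBlocks, map_unit hf, Matrix.fromBlocks_multiply]
    simp

lemma fromBlocks {e : ↥V} (he : ‖(e : H →L[ℂ] H)‖ = 1) (hf : f e = 1) {A : Matrix k l 𝒜}
    {D : Matrix k' l' 𝒜} (hA : FactorizationBall f A) (hD : FactorizationBall f D) :
    FactorizationBall f (Matrix.fromBlocks A 0 0 D) := by
  classical
  convert mul (fromBlocks_one (m := k') he hf hA) (one_fromBlocks (m := l) he hf hD) using 1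
  rw [Matrix.fromBlocks_multiply]
  simp

variable (f) in
/-- Some positive multiple of the matrix lies in the ball. -/
def IsAbsorbed (A : Matrix k l 𝒜) : Prop := ∃ c : ℝ, 0 < c ∧ FactorizationBall f ((c : ℂ) • A)

lemma smul {e : ↥V} (he : ‖(e : H →L[ℂ] H)‖ = 1) (hf : f e = 1) {c : ℂ} (hc : ‖c‖ ≤ 1)
    {A : Matrix k l 𝒜} (hA : FactorizationBall f A) : FactorizationBall f (c • A) := by
  classical
  have h := mul (scalar he hf (isScalarContraction_smul_one (ι := k) hc)) hA
  rwa [MatrixBall.map_smul_one, Matrix.smul_mul, Matrix.one_mul] at h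

lemma IsAbsorbed.mul {A : Matrix k l 𝒜} {D : Matrix l m 𝒜} (hA : IsAbsorbed f A)
    (hD : IsAbsorbed f D) : IsAbsorbed f (A * D) := by
  obtain ⟨c, hc, hA⟩ := hA
  obtain ⟨d, hd, hD⟩ := hD
  refine ⟨c * d, mul_pos hc hd, ?_⟩
  convert hA.mul hD using 1
  rw [Matrix.smul_mul, Matrix.mul_smul, smul_smul, Complex.ofReal_mul]

lemma IsAbsorbed.add {e : ↥V} (he : ‖(e : H →L[ℂ] H)‖ = 1) (hf : f e = 1) {A D : Matrix k l 𝒜}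
    (hA : IsAbsorbed f A) (hD : IsAbsorbed f D) : IsAbsorbed f (A + D) := by
  classical
  obtain ⟨c, hc, hA⟩ := hA
  obtain ⟨d, hd, hD⟩ := hD
  have key : ∀ {c d : ℝ} {A : Matrix k l 𝒜}, 0 < c → 0 < d → FactorizationBall f ((c : ℂ) • A) →
      FactorizationBall f (((min c d : ℝ) : ℂ) • A) := by
    intro c d A hc hd hA
    have h := smul he hf (c := ((min c d / c : ℝ) : ℂ)) (by
      rw [Complex.norm_real, Real.norm_of_nonneg (div_nonneg (le_min hc.le hd.le) hc.le)]
      exact (div_le_one hc).2 (min_le_left c d)) hA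
    rwa [smul_smul, ← Complex.ofReal_mul, div_mul_cancel₀ _ hc.ne'] at h
  have hA' := key hc hd hA
  have hD' := key hd hc hD
  rw [min_comm] at hD'
  have hs : (3 / 5 : ℝ) ^ 2 + (3 / 5) ^ 2 ≤ 1 := by norm_num
  refine ⟨9 / 25 * min c d, by positivity, ?_⟩
  convert FactorizationBall.mul (scalar he hf (isScalarContraction_fromCols (ι := k) hs))
    (FactorizationBall.mul (FactorizationBall.fromBlocks he hf hA' hD') (scalar he hf (isScalarContraction_fromRows (ι := l) hs))) using 1
  have h1 : (Matrix.fromCols (((3 / 5 : ℝ) : ℂ) • 1) (((3 / 5 : ℝ) : ℂ) • 1) :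
      Matrix k (k ⊕ k) ℂ).map (algebraMap ℂ 𝒜) =
      Matrix.fromCols (((3 / 5 : ℝ) : ℂ) • 1) (((3 / 5 : ℝ) : ℂ) • 1) := by
    rw [← MatrixBall.map_smul_one (𝒜 := 𝒜)]
    ext i (j | j) <;> rfl
  have h2 : (Matrix.fromRows (((3 / 5 : ℝ) : ℂ) • 1) (((3 / 5 : ℝ) : ℂ) • 1) :
      Matrix (l ⊕ l) l ℂ).map (algebraMap ℂ 𝒜) =
      Matrix.fromRows (((3 / 5 : ℝ) : ℂ) • 1) (((3 / 5 : ℝ) : ℂ) • 1) := by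
    rw [← MatrixBall.map_smul_one (𝒜 := 𝒜)]
    ext (i | i) j <;> rfl
  rw [h1, h2, Matrix.fromBlocks_mul_fromRows, Matrix.fromCols_mul_fromRows]
  simp only [Matrix.smul_mul, Matrix.mul_smul, Matrix.one_mul, Matrix.mul_one,
    add_zero, zero_add, smul_smul, smul_zero, smul_add]
  congr 2 <;> push_cast <;> ring

lemma isAbsorbed_map (X : Matrix k l ↥V) : IsAbsorbed f (X.map f) := by
  have h0 : 0 ≤ subMatNorm X := opMatNorm_nonneg _
  have hc : 0 < (subMatNorm X + 1)⁻¹ := by positivity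
  refine ⟨(subMatNorm X + 1)⁻¹, hc, ?_⟩
  convert single (f := f) ((((subMatNorm X + 1)⁻¹ : ℝ) : ℂ) • X) ?_ using 1
  · ext i j
    exact (f.map_smul _ _).symm
  · refine (opMatNorm_smul_le _ (X.map fun v => (v : H →L[ℂ] H))).trans ?_
    rw [Complex.norm_real, Real.norm_of_nonneg hc.le, inv_mul_le_iff₀ (by positivity)]
    change subMatNorm X ≤ _
    linarith

lemma isAbsorbed_scalar {e : ↥V} (hf : f e = 1) (α : Matrix k l ℂ) :
    IsAbsorbed f (α.map (algebraMap ℂ 𝒜)) := by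
  convert isAbsorbed_map (f := f) (α.map fun c => c • e) using 1
  ext i j
  simp [hf, Algebra.algebraMap_eq_smul_one]

lemma isAbsorbed_of_adjoin {e : ↥V} (he : ‖(e : H →L[ℂ] H)‖ = 1) (hf : f e = 1)
    (hgen : Algebra.adjoin ℂ (Set.range f) = ⊤) (A : Matrix k l 𝒜) : IsAbsorbed f A := by
  classical
  have hentry : ∀ a : 𝒜, IsAbsorbed f (Matrix.of fun _ _ : Unit => a) := by
    intro a
    have ha : a ∈ Algebra.adjoin ℂ (Set.range f) := hgen ▸ Algebra.mem_top
    induction ha using Algebra.adjoin_induction with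
    | mem x hx =>
      obtain ⟨v, rfl⟩ := hx
      exact isAbsorbed_map (Matrix.of fun _ _ : Unit => v)
    | algebraMap c => exact isAbsorbed_scalar hf (Matrix.of fun _ _ : Unit => c)
    | add x y _ _ hx hy => exact hx.add he hf hy
    | mul x y _ _ hx hy =>
      convert hx.mul hy using 1
      ext
      simp [Matrix.mul_apply]
  induction A using Matrix.induction_on' with
  | h_zero => simpa using isAbsorbed_scalar (k := k) (l := l) hf 0
  | h_add p q hp hq => exact hp.add he hf hq
  | h_std_basis i j x =>
    convert (isAbsorbed_scalar hf (Matrix.of fun a (_ : Unit) => if a = i then 1 else 0)).mul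
      ((hentry x).mul
        (isAbsorbed_scalar hf (Matrix.of fun (_ : Unit) b => if b = j then 1 else 0))) using 1
    ext a b
    by_cases ha : i = a <;> by_cases hb : j = b <;>
      simp [Matrix.mul_apply, ha, hb, @eq_comm _ _ i, @eq_comm _ _ j]

/-- The unit ball of the factorization norms on an algebra generated by the image of `V`. -/
def matrixBall {e : ↥V} (he : ‖(e : H →L[ℂ] H)‖ = 1) (hf : f e = 1)
    (hgen : Algebra.adjoin ℂ (Set.range f) = ⊤) : MatrixBall 𝒜 where
  Mem A := FactorizationBall f A
  mul := mul
  fromBlocks := fromBlocks he hf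
  scalar := scalar he hf
  exists_smul := isAbsorbed_of_adjoin he hf hgen

/-- Elements of the ball are the products of chains of cost at most one. -/
lemma exists_matChain {A : Matrix k l 𝒜} (hA : FactorizationBall f A) {n d : ℕ} (e₁ : Fin n ≃ k)
    (e₂ : Fin d ≃ l) : ∃ C : MatChain ↥V n d, 1 ≤ C.len ∧ C.prodIn f = A.submatrix e₁ e₂ ∧
      chainCost C ≤ 1 := by
  induction hA generalizing n d with
  | single X hX =>
    refine ⟨MatChain.cons (X.submatrix e₁ e₂) (MatChain.nil d), MatChain.one_le_len_cons _ _, ?_, ?_⟩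
    · rw [MatChain.prodIn_cons, MatChain.prodIn_nil, Matrix.mul_one]
      rfl
    · rw [MatChain.chainCost_cons, MatChain.chainCost_nil, mul_one]
      exact (opMatNorm_submatrix (X.map fun v => (v : H →L[ℂ] H)) e₁ e₂).trans_le hX
  | @cons k d' l _ _ _ X Z hX _ ih =>
    let e := (Fintype.equivFin d').symm
    obtain ⟨C, -, hC, hcost⟩ := ih e e₂
    refine ⟨MatChain.cons (X.submatrix e₁ e) C, MatChain.one_le_len_cons _ _, ?_, ?_⟩
    · rw [MatChain.prodIn_cons, hC, ← Matrix.submatrix_mul_equiv (X.map f) Z e₁ e e₂,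
        Matrix.submatrix_map]
    · rw [MatChain.chainCost_cons]
      have hX' : subMatNorm (X.submatrix e₁ e) ≤ 1 :=
        (opMatNorm_submatrix (X.map fun v => (v : H →L[ℂ] H)) e₁ e).trans_le hX
      exact mul_le_one₀ hX' (Finset.prod_nonneg fun _ _ => opMatNorm_nonneg _) hcost

end FactorizationBall

/-! ### Passage from the free algebra to a unital algebra -/

lemma exists_adjoin_range_eq_top {W T : Type} [AddCommGroup W] [Module ℂ W] [Ring T] [Algebra ℂ T]
    {L : W →ₗ[ℂ] T} {e : W} (hL : L e = 1) :
    ∃ (𝒜 : Type) (_ : Ring 𝒜) (_ : Algebra ℂ 𝒜) (f : W →ₗ[ℂ] 𝒜) (φ : 𝒜 →ₐ[ℂ] T), f e = 1 ∧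
      Algebra.adjoin ℂ (Set.range f) = ⊤ ∧ ∀ v, φ (f v) = L v := by
  let S : Subalgebra ℂ T := Algebra.adjoin ℂ (Set.range L)
  let f : W →ₗ[ℂ] S := L.codRestrict (Subalgebra.toSubmodule S)
    fun v => Algebra.subset_adjoin (Set.mem_range_self v)
  refine ⟨S, inferInstance, inferInstance, f, S.val, Subtype.ext hL, ?_, fun v => rfl⟩
  rw [← Algebra.adjoin_adjoin_coe_preimage]
  congr 1
  ext x
  exact ⟨fun ⟨v, hv⟩ => ⟨v, congrArg Subtype.val hv⟩, fun ⟨v, hv⟩ => ⟨v, Subtype.ext hv⟩⟩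

lemma exists_unital_algebra {W R : Type} [AddCommGroup W] [Module ℂ W] [Ring R] [Algebra ℂ R]
    (g : W →ₗ[ℂ] R) {e : W} (hl : ∀ v, g e * g v = g v) (hr : ∀ v, g v * g e = g v) :
    ∃ (𝒜 : Type) (_ : Ring 𝒜) (_ : Algebra ℂ 𝒜) (f : W →ₗ[ℂ] 𝒜), f e = 1 ∧
      Algebra.adjoin ℂ (Set.range f) = ⊤ ∧
      ∀ {n k : ℕ} (C : MatChain W n k) (A : Matrix (Fin n) (Fin k) W), 1 ≤ C.len →
        C.prodIn f = A.map f → C.prodIn g = A.map g := by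
  let U : Submodule ℂ R := LinearMap.eqLocus (LinearMap.mulLeft ℂ (g e)) LinearMap.id
  have hU : ∀ v, ∀ x ∈ U, LinearMap.mulLeft ℂ (g v) x ∈ U := fun v x _ => by
    change g e * (g v * x) = g v * x
    rw [← mul_assoc, hl]
  let L : W →ₗ[ℂ] Module.End ℂ U :=
    { toFun := fun v => (LinearMap.mulLeft ℂ (g v)).restrict (hU v)
      map_add' := fun v w => by
        ext x
        change g (v + w) * (x : R) = g v * x + g w * x
        rw [map_add, add_mul]
      map_smul' := fun c v => by
        ext x
        change g (c • v) * (x : R) = c • (g v * x)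
        rw [map_smul, smul_mul_assoc] }
  have hLe : L e = 1 := LinearMap.ext fun x => Subtype.ext x.2
  have hlist : ∀ (l : List W) (x : U), (((l.map L).prod x : U) : R) = (l.map g).prod * x := by
    intro l x
    induction l with
    | nil => simp
    | cons v l ih =>
      rw [List.map_cons, List.prod_cons, List.map_cons, List.prod_cons, mul_assoc, ← ih]
      rfl
  have hlist' : ∀ l : List W, l ≠ [] → (l.map g).prod * g e = (l.map g).prod := by
    intro l hne
    induction l with
    | nil => exact absurd rfl hne
    | cons v l ih =>
      rw [List.map_cons, List.prod_cons, mul_assoc]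
      rcases eq_or_ne l [] with rfl | hne'
      · simp [hr]
      · rw [ih hne']
  have htransfer : ∀ {n k : ℕ} (C : MatChain W n k), 1 ≤ C.len → ∀ i j,
      ((C.prodIn L i j ⟨g e, hl e⟩ : U) : R) = C.prodIn g i j := by
    intro n k C hC i j
    simp only [MatChain.prodIn, Matrix.of_apply, LinearMap.sum_apply,
      AddSubmonoidClass.coe_finsetSum]
    refine Finset.sum_congr rfl fun p _ => ?_
    set l := List.ofFn fun t : Fin C.len => C.mats t (p t.castSucc) (p t.succ) with hldef
    have hlne : l ≠ [] := by
      rw [hldef, Ne, List.ofFn_eq_nil_iff]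
      omega
    have h := hlist l ⟨g e, hl e⟩
    rw [hlist' l hlne, hldef, List.map_ofFn, List.map_ofFn] at h
    exact h
  obtain ⟨𝒜, _, _, f, φ, hfe, hgen, hφ⟩ := exists_adjoin_range_eq_top (T := Module.End ℂ U) (L := L) hLe
  refine ⟨𝒜, _, _, f, hfe, hgen, fun {n k} C A hC h => ?_⟩
  ext i j
  have h1 : C.prodIn L = (C.prodIn f).map (φ : 𝒜 →+* Module.End ℂ U) := by
    rw [← MatChain.prodIn_comp]
    exact congrArg C.prodIn (funext fun v => (hφ v).symm)
  rw [← htransfer C hC, h1, h]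
  exact (congrArg (fun T : Module.End ℂ U => (T ⟨g e, hl e⟩ : R)) (hφ (A i j))).trans (hr (A i j))

section FactNorm

variable {V : Submodule ℂ (H →L[ℂ] H)} {e : ↥V}

lemma chainCost_nonneg {n k : ℕ} (C : MatChain ↥V n k) : 0 ≤ chainCost C :=
  Finset.prod_nonneg fun _ _ => opMatNorm_nonneg _

lemma factNorm_le_chainCost (P : PartialProduct ↥V e) {n k : ℕ} {A : Matrix (Fin n) (Fin k) ↥V}
    {C : MatChain ↥V n k} (hC : 1 ≤ C.len) (h : C.prodIn P.emb = A.map P.emb) :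
    factNorm P A ≤ chainCost C := by
  refine csInf_le ⟨0, ?_⟩ ⟨C, hC, h, rfl⟩
  rintro _ ⟨C, -, -, rfl⟩
  exact chainCost_nonneg C

lemma PartialProduct.emb_mul_emb {W : Type*} [AddCommGroup W] [Module ℂ W] {u : W}
    (P : PartialProduct W u) {a b : W} (h : (a, b) ∈ P.D) :
    P.emb a * P.emb b = P.emb (P.m a b) := by
  rw [PartialProduct.emb, PartialProduct.emb, PartialProduct.emb, ← map_mul]
  exact RingQuot.mkAlgHom_rel ℂ ⟨a, b, h, rfl, rfl⟩

lemma PartialProduct.emb_unit_mul {W : Type*} [AddCommGroup W] [Module ℂ W] {u : W}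
    (P : PartialProduct W u) (v : W) : P.emb u * P.emb v = P.emb v := by
  rw [P.emb_mul_emb (by simpa using P.unit_left 1 v), P.m_unital_left]

lemma PartialProduct.emb_mul_unit {W : Type*} [AddCommGroup W] [Module ℂ W] {u : W}
    (P : PartialProduct W u) (v : W) : P.emb v * P.emb u = P.emb v := by
  rw [P.emb_mul_emb (by simpa using P.unit_right 1 v), P.m_unital_right]

/-- The canonical map `V → F_m(V)` as a linear map. -/
def PartialProduct.embLinear {W : Type*} [AddCommGroup W] [Module ℂ W] {u : W}
    (P : PartialProduct W u) : W →ₗ[ℂ] P.FreeAlg :=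
  (RingQuot.mkAlgHom ℂ P.rel).toLinearMap ∘ₗ TensorAlgebra.ι ℂ

lemma opMatNorm_map_le_factNorm (hne : e ≠ 0) {L : Type} [NormedAddCommGroup L]
    [InnerProductSpace ℂ L] [CompleteSpace L] {ρ : ↥V →ₗ[ℂ] (L →L[ℂ] L)} (hρe : ρ e = 1)
    (hρ : ∀ (a b : ℕ) (X : Matrix (Fin a) (Fin b) ↥V), opMatNorm (X.map ρ) ≤ subMatNorm X)
    {n k : ℕ} (A : Matrix (Fin n) (Fin k) ↥V) :
    opMatNorm (A.map ρ) ≤ factNorm (trivPP hne) A := by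
  have hrel : ∀ ⦃p q : TensorAlgebra ℂ ↥V⦄, (trivPP hne).rel p q →
      TensorAlgebra.lift ℂ ρ p = TensorAlgebra.lift ℂ ρ q := by
    rintro _ _ ⟨a, b, hab, rfl, rfl⟩
    rw [map_mul, TensorAlgebra.lift_ι_apply, TensorAlgebra.lift_ι_apply,
      TensorAlgebra.lift_ι_apply]
    rcases hab with ⟨c, rfl : a = c • e⟩ | ⟨c, rfl : b = c • e⟩
    · change _ = ρ (trivMul e _ _)
      rw [trivMul_smul_left hne, map_smul, map_smul, hρe, smul_mul_assoc, one_mul]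
    · change _ = ρ (trivMul e _ _)
      rw [trivMul_smul_right hne, map_smul, map_smul, hρe, mul_smul_comm, mul_one]
  let Φ : (trivPP hne).FreeAlg →ₐ[ℂ] (L →L[ℂ] L) :=
    RingQuot.liftAlgHom ℂ ⟨TensorAlgebra.lift ℂ ρ, hrel⟩
  have hΦ : ∀ v, Φ ((trivPP hne).emb v) = ρ v := fun v => by
    rw [PartialProduct.emb, RingQuot.liftAlgHom_mkAlgHom_apply, TensorAlgebra.lift_ι_apply]
  refine le_csInf ⟨_, MatChain.cons A (MatChain.nil k), MatChain.one_le_len_cons _ _, ?_, rfl⟩ ?_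
  · rw [MatChain.prodIn_cons, MatChain.prodIn_nil, Matrix.mul_one]
  rintro _ ⟨C, -, hC, rfl⟩
  have h1 : A.map ρ = C.prodIn ρ := by
    have h2 := MatChain.prodIn_comp C (trivPP hne).emb (Φ : (trivPP hne).FreeAlg →+* (L →L[ℂ] L))
    have h3 : (fun v => (Φ : (trivPP hne).FreeAlg →+* (L →L[ℂ] L)) ((trivPP hne).emb v)) = ρ :=
      funext hΦ
    rw [h3, hC] at h2
    rw [h2]
    ext1 i j
    exact (hΦ (A i j)).symm
  rw [h1]
  exact MatChain.opMatNorm_prodIn_le ρ hρ C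

lemma factNorm_le_of_factorizationBall (he : ‖(e : H →L[ℂ] H)‖ = 1) {P : PartialProduct ↥V e}
    {𝒜 : Type} [Ring 𝒜] [Algebra ℂ 𝒜] {f : ↥V →ₗ[ℂ] 𝒜} (hf : f e = 1)
    (htransfer : ∀ {n k : ℕ} (C : MatChain ↥V n k) (A : Matrix (Fin n) (Fin k) ↥V), 1 ≤ C.len →
      C.prodIn f = A.map f → C.prodIn P.emb = A.map P.emb)
    {n k : ℕ} {A : Matrix (Fin n) (Fin k) ↥V} {r : ℝ} (hr : 0 < r)
    (hA : FactorizationBall f ((r : ℂ)⁻¹ • A.map f)) : factNorm P A ≤ r := by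
  obtain ⟨C, -, hC, hcost⟩ := hA.exists_matChain (Equiv.refl (Fin n)) (Equiv.refl (Fin k))
  let E : Matrix (Fin n) (Fin n) ↥V := (1 : Matrix (Fin n) (Fin n) ℂ).map fun c => c • e
  have hE : subMatNorm E ≤ 1 := FactorizationBall.subMatNorm_smul_unit_le he isScalarContraction_one
  have hEr : subMatNorm ((r : ℂ) • E) ≤ r := by
    refine (opMatNorm_smul_le (r : ℂ) (E.map fun v => (v : H →L[ℂ] H))).trans ?_
    rw [Complex.norm_real, Real.norm_of_nonneg hr.le]
    exact mul_le_of_le_one_right hr.le hE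
  have hmap : ((r : ℂ) • E).map f = (r : ℂ) • (1 : Matrix (Fin n) (Fin n) 𝒜) := by
    rw [← FactorizationBall.map_unit hf]
    ext i j
    exact f.map_smul _ _
  refine (factNorm_le_chainCost P (C := MatChain.cons ((r : ℂ) • E) C)
    (MatChain.one_le_len_cons _ _) (htransfer _ A (MatChain.one_le_len_cons _ _) ?_)).trans ?_
  · have hr' : (r : ℂ) ≠ 0 := Complex.ofReal_ne_zero.2 hr.ne'
    rw [MatChain.prodIn_cons, hmap, hC, Matrix.smul_mul, Matrix.one_mul]
    ext i j
    exact smul_inv_smul₀ hr' (f (A i j))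
  · rw [MatChain.chainCost_cons]
    exact (mul_le_mul hEr hcost (chainCost_nonneg C) hr.le).trans (mul_one r).le

end FactNorm

/-! ### Direct sums of representations -/

section DirectSum

variable {V : Submodule ℂ (H →L[ℂ] H)}

/-- The linear map into `B(K)` is completely contractive for the matrix norms of `B(H)`. -/
def IsCompletelyContractive {K : Type} [NormedAddCommGroup K] [InnerProductSpace ℂ K]
    [CompleteSpace K] (ρ : ↥V →ₗ[ℂ] (K →L[ℂ] K)) : Prop :=
  ∀ (a b : ℕ) (X : Matrix (Fin a) (Fin b) ↥V), opMatNorm (X.map ρ) ≤ subMatNorm X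

section

variable {K : Type} [NormedAddCommGroup K] [InnerProductSpace ℂ K] [CompleteSpace K]
  {ρ : ↥V →ₗ[ℂ] (K →L[ℂ] K)}

lemma IsCompletelyContractive.norm_apply_le (hρ : IsCompletelyContractive ρ) (v : ↥V) (x : K) :
    ‖ρ v x‖ ≤ ‖(v : H →L[ℂ] H)‖ * ‖x‖ := by
  let X : Matrix (Fin 1) (Fin 1) ↥V := Matrix.of fun _ _ => v
  have hX : opMatNorm (X.map ρ) ≤ ‖(v : H →L[ℂ] H)‖ := by
    refine (hρ 1 1 X).trans (opMatNorm_le (norm_nonneg _) fun y => ?_)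
    simpa [X, mul_pow] using pow_le_pow_left₀ (norm_nonneg _) ((v : H →L[ℂ] H).le_opNorm (y 0)) 2
  have h := sum_norm_sq_le_opMatNorm (X.map ρ) fun _ => x
  simp only [Finset.univ_unique, Finset.sum_singleton, ← mul_pow] at h
  refine (le_of_sq_le_sq h (by positivity [opMatNorm_nonneg (X.map ρ)])).trans ?_
  exact mul_le_mul_of_nonneg_right hX (norm_nonneg x)

lemma isCompletelyContractive_of_ball
    (h : ∀ (a b : ℕ) (X : Matrix (Fin a) (Fin b) ↥V), subMatNorm X ≤ 1 → opMatNorm (X.map ρ) ≤ 1) :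
    IsCompletelyContractive ρ := by
  intro a b X
  refine le_of_forall_gt_imp_ge_of_dense fun c hc => ?_
  have hX0 : 0 ≤ subMatNorm X := opMatNorm_nonneg _
  have hc0 : 0 < c := hX0.trans_lt hc
  have hc0' : (c : ℂ) ≠ 0 := Complex.ofReal_ne_zero.2 hc0.ne'
  have h1 : subMatNorm ((c : ℂ)⁻¹ • X) ≤ 1 := by
    refine (opMatNorm_smul_le (c : ℂ)⁻¹ (X.map fun v => (v : H →L[ℂ] H))).trans ?_
    rw [norm_inv, Complex.norm_real, Real.norm_of_nonneg hc0.le, inv_mul_le_one₀ hc0]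
    exact hc.le
  have h2 : X.map ρ = (c : ℂ) • ((c : ℂ)⁻¹ • X).map ρ := by
    ext1 i j
    change ρ (X i j) = (c : ℂ) • ρ ((c : ℂ)⁻¹ • X i j)
    rw [map_smul, smul_inv_smul₀ hc0']
  rw [h2]
  refine (opMatNorm_smul_le _ _).trans ?_
  rw [Complex.norm_real, Real.norm_of_nonneg hc0.le]
  exact mul_le_of_le_one_right hc0.le (h a b _ h1)

end

lemma exists_directSum {e : ↥V} {I : Type} {K : I → Type} [∀ i, NormedAddCommGroup (K i)]
    [∀ i, InnerProductSpace ℂ (K i)] [∀ i, CompleteSpace (K i)]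
    {π : ∀ i, ↥V →ₗ[ℂ] (K i →L[ℂ] K i)} (hπe : ∀ i, π i e = 1)
    (hπ : ∀ i, IsCompletelyContractive (π i)) :
    ∃ (G : Type) (_ : NormedAddCommGroup G) (_ : InnerProductSpace ℂ G) (_ : CompleteSpace G)
      (σ : ↥V →ₗ[ℂ] (G →L[ℂ] G)), σ e = 1 ∧ IsCompletelyContractive σ ∧
      ∀ i {n k : ℕ} (A : Matrix (Fin n) (Fin k) ↥V),
        opMatNorm (A.map (π i)) ≤ opMatNorm (A.map σ) := by
  classical
  have h2 : 0 < (2 : ENNReal).toReal := by norm_num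
  have hnorm : ∀ x : lp K 2, HasSum (fun i => ‖x i‖ ^ 2) (‖x‖ ^ 2) := fun x => by
    simpa using lp.hasSum_norm h2 x
  have hmem : ∀ (v : ↥V) (x : lp K 2), Memℓp (fun i => π i v (x i)) 2 := fun v x => by
    refine (memℓp_gen_iff h2).2 (.of_nonneg_of_le (fun i => by positivity) (fun i => ?_)
      ((hnorm x).summable.mul_left (‖(v : H →L[ℂ] H)‖ ^ 2)))
    simpa [mul_pow] using pow_le_pow_left₀ (norm_nonneg _) ((hπ i).norm_apply_le v (x i)) 2
  let T : ↥V → lp K 2 → lp K 2 := fun v x => ⟨fun i => π i v (x i), hmem v x⟩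
  have hT : ∀ v x, ‖T v x‖ ≤ ‖(v : H →L[ℂ] H)‖ * ‖x‖ := fun v x => by
    refine le_of_sq_le_sq ?_ (by positivity)
    rw [mul_pow]
    refine hasSum_le (fun i => ?_) (hnorm (T v x)) ((hnorm x).mul_left _)
    rw [← mul_pow]
    exact pow_le_pow_left₀ (norm_nonneg _) ((hπ i).norm_apply_le v (x i)) 2
  let σ : ↥V →ₗ[ℂ] (lp K 2 →L[ℂ] lp K 2) :=
    { toFun := fun v => LinearMap.mkContinuous
        { toFun := T v
          map_add' := fun x y => lp.ext (funext fun i => map_add (π i v) (x i) (y i))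
          map_smul' := fun c x => lp.ext (funext fun i => map_smul (π i v) c (x i)) } _ (hT v)
      map_add' := fun v w => by
        ext1 x
        exact lp.ext (funext fun i => congrArg (fun S => S (x i)) (map_add (π i) v w))
      map_smul' := fun c v => by
        ext1 x
        exact lp.ext (funext fun i => congrArg (fun S => S (x i)) (map_smul (π i) c v)) }
  have hσ : ∀ v (x : lp K 2) i, σ v x i = π i v (x i) := fun v x i => rfl
  have hsum : ∀ {n k : ℕ} (A : Matrix (Fin n) (Fin k) ↥V) (x : Fin k → lp K 2) a i,
      (∑ b, A.map σ a b (x b)) i = ∑ b, (A.map (π i)) a b (x b i) := fun A x a i => by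
    rw [lp.coeFn_sum, Finset.sum_apply]
    rfl
  refine ⟨lp K 2, inferInstance, inferInstance, inferInstance, σ, ?_, fun n k A => ?_,
    fun i n k A => ?_⟩
  · ext1 x
    exact lp.ext (funext fun i => congrArg (fun S => S (x i)) (hπe i))
  · refine opMatNorm_le (opMatNorm_nonneg _) fun x => ?_
    refine hasSum_le (fun i => ?_) (hasSum_sum fun a _ => hnorm (∑ b, A.map σ a b (x b)))
      ((hasSum_sum fun b _ => hnorm (x b)).mul_left _)
    simp_rw [hsum]
    refine (sum_norm_sq_le_opMatNorm _ _).trans (mul_le_mul_of_nonneg_right ?_ (by positivity))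
    exact pow_le_pow_left₀ (opMatNorm_nonneg _) (hπ i n k A) 2
  · refine opMatNorm_le (opMatNorm_nonneg _) fun x => ?_
    have h := sum_norm_sq_le_opMatNorm (A.map σ) fun b => lp.single 2 i (x b)
    simp_rw [lp.norm_single (E := K) (p := 2) (by norm_num)] at h
    refine le_trans (Finset.sum_le_sum fun a _ => ?_) h
    refine pow_le_pow_left₀ (norm_nonneg _) ?_ 2
    refine le_trans (le_of_eq ?_) (lp.norm_apply_le_norm (by norm_num)
      (∑ b, A.map σ a b (lp.single 2 i (x b))) i)
    rw [hsum]
    simp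

end DirectSum

section Main

variable {V : Submodule ℂ (H →L[ℂ] H)} {e : ↥V}

lemma exists_representation_of_lt_factNorm (he : ‖(e : H →L[ℂ] H)‖ = 1) (P : PartialProduct ↥V e)
    {n : ℕ} {A : Matrix (Fin n) (Fin n) ↥V} {r : ℝ} (hr : 0 < r) (hA : r < factNorm P A) :
    ∃ (K : Type) (_ : NormedAddCommGroup K) (_ : InnerProductSpace ℂ K) (_ : CompleteSpace K)
      (π : ↥V →ₗ[ℂ] (K →L[ℂ] K)), π e = 1 ∧ IsCompletelyContractive π ∧
        r ≤ opMatNorm (A.map π) := by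
  obtain ⟨𝒜, _, _, f, hf, hgen, htransfer⟩ :=
    exists_unital_algebra P.embLinear P.emb_unit_mul P.emb_mul_unit
  have hmem : ¬ (FactorizationBall.matrixBall he hf hgen).Mem ((r : ℂ)⁻¹ • A.map f) := fun h =>
    hA.not_ge (factNorm_le_of_factorizationBall he hf htransfer hr h)
  obtain ⟨K, _, _, _, π, hπ, hball, hrA⟩ := MatrixBall.exists_representation hr hmem
  refine ⟨K, _, _, ‹_›, π ∘ₗ f, (congrArg π hf).trans hπ,
    isCompletelyContractive_of_ball fun a b X hX => ?_, ?_⟩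
  · exact hball _ _ (X.map f) (FactorizationBall.single X hX)
  · exact hrA

lemma exists_representation_factNorm (he : ‖(e : H →L[ℂ] H)‖ = 1) (hne : e ≠ 0) :
    ∃ (K : Type) (_ : NormedAddCommGroup K) (_ : InnerProductSpace ℂ K) (_ : CompleteSpace K)
      (π : ↥V →ₗ[ℂ] (K →L[ℂ] K)), π e = 1 ∧ ∀ (n : ℕ) (A : Matrix (Fin n) (Fin n) ↥V),
        opMatNorm (A.map ⇑π) = factNorm (trivPP hne) A := by
  let I := { p : (Σ n : ℕ, Matrix (Fin n) (Fin n) ↥V) × ℝ //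
    0 < p.2 ∧ p.2 < factNorm (trivPP hne) p.1.2 }
  choose K _ _ _ π hπe hπ hr using fun i : I =>
    exists_representation_of_lt_factNorm he (trivPP hne) i.2.1 i.2.2
  obtain ⟨G, _, _, _, σ, hσe, hσ, hle⟩ := exists_directSum hπe hπ
  refine ⟨G, _, _, ‹_›, σ, hσe, fun n A =>
    le_antisymm (opMatNorm_map_le_factNorm hne hσe hσ A) (le_of_forall_lt_imp_le_of_dense ?_)⟩
  intro r hrA
  rcases le_or_gt r 0 with hr0 | hr0
  · exact hr0.trans (opMatNorm_nonneg _)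
  · exact (hr ⟨(⟨n, A⟩, r), hr0, hrA⟩).trans (hle _ A)

lemma isCompletelyContractive_of_square {K : Type} [NormedAddCommGroup K] [InnerProductSpace ℂ K]
    [CompleteSpace K] {ρ : ↥V →ₗ[ℂ] (K →L[ℂ] K)}
    (h : ∀ (n : ℕ) (X : Matrix (Fin n) (Fin n) ↥V), opMatNorm (X.map ρ) ≤ subMatNorm X) :
    IsCompletelyContractive ρ := by
  intro a b X
  let q : Fin (a + b) ≃ Fin a ⊕ Fin b := finSumFinEquiv.symm
  let Y : Matrix (Fin a ⊕ Fin b) (Fin a ⊕ Fin b) ↥V := Matrix.fromBlocks 0 X 0 0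
  have hY : ∀ {G : Type} [NormedAddCommGroup G] [InnerProductSpace ℂ G] [CompleteSpace G]
      (g : ↥V →ₗ[ℂ] (G →L[ℂ] G)),
      opMatNorm ((Y.submatrix q q).map g) = opMatNorm (X.map g) := by
    intro G _ _ _ g
    rw [← Matrix.submatrix_map, opMatNorm_submatrix, ← opMatNorm_fromBlocks_zero (X.map g),
      Matrix.fromBlocks_map]
    congr 2 <;> ext1 <;> simp
  rw [← hY ρ]
  exact (h _ _).trans_eq (hY V.subtype)

end Main

/-- **The unital factorization norm is the largest unital operator space structure dominated
by the given norms.**  Let `V ⊆ B(H)` be a linear subspace with `e ∈ V`, `‖e‖ = 1`, and let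
`m` be the trivial partial product with unit `e`.  Suppose the factorization seminorms
`‖·‖ⁿᵉ` are norms.  Then (a) there is a Hilbert space `K` and a linear map `π : V → B(K)`
with `π(e) = I` realizing the factorization norms; and (b) any family of norms on the
`Mₙ(V)`'s which is dominated by the inherited norms and is realized by some unital linear
map into some `B(L)` is dominated by the factorization norms. -/
theorem trivial_factorization_norm_universal
    (V : Submodule ℂ (H →L[ℂ] H)) (e : ↥V)
    (he : ‖(e : H →L[ℂ] H)‖ = 1) (hne : e ≠ 0)
    (hnorm : ∀ (n : ℕ) (A : Matrix (Fin n) (Fin n) ↥V), A ≠ 0 →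
      0 < factNorm (trivPP hne) A) :
    (∃ (K : Type) (_ : NormedAddCommGroup K) (_ : InnerProductSpace ℂ K) (_ : CompleteSpace K)
      (π : ↥V →ₗ[ℂ] (K →L[ℂ] K)),
      π e = 1 ∧ ∀ (n : ℕ) (A : Matrix (Fin n) (Fin n) ↥V),
        opMatNorm (A.map ⇑π) = factNorm (trivPP hne) A) ∧
    (∀ (N' : ∀ n : ℕ, Matrix (Fin n) (Fin n) ↥V → ℝ),
      (∀ (n : ℕ) (x : Matrix (Fin n) (Fin n) ↥V), x ≠ 0 → 0 < N' n x) →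
      (∀ (n : ℕ) (c : ℂ) (x : Matrix (Fin n) (Fin n) ↥V), N' n (c • x) = ‖c‖ * N' n x) →
      (∀ (n : ℕ) (x y : Matrix (Fin n) (Fin n) ↥V), N' n (x + y) ≤ N' n x + N' n y) →
      (∀ (n : ℕ) (x : Matrix (Fin n) (Fin n) ↥V), N' n x ≤ subMatNorm x) →
      (∃ (L : Type) (_ : NormedAddCommGroup L) (_ : InnerProductSpace ℂ L)
          (_ : CompleteSpace L) (ρ : ↥V →ₗ[ℂ] (L →L[ℂ] L)),
        ρ e = 1 ∧ ∀ (n : ℕ) (x : Matrix (Fin n) (Fin n) ↥V),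
          opMatNorm (x.map ⇑ρ) = N' n x) →
      ∀ (n : ℕ) (x : Matrix (Fin n) (Fin n) ↥V), N' n x ≤ factNorm (trivPP hne) x) := by
  refine ⟨exists_representation_factNorm he hne, ?_⟩
  rintro N' - - - hN' ⟨L, _, _, _, ρ, hρe, hρ⟩ n x
  rw [← hρ]
  exact opMatNorm_map_le_factNorm hne hρe
    (isCompletelyContractive_of_square fun n X => (hρ n X).trans_le (hN' n X)) x
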